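/- arXiv:1212.3064 — 3 statements merged into one kernel-verified Lean document; each statement's English description precedes it below -/
import Mathlib

section
/- If the coloring φ is not periodic, then b_φ(n) ≥ n + 2 for every n ∈ ℕ. -/
open SimpleGraph

/-- Equivalence of colored `n`-balls around `x` and `y`: a graph isomorphism between the
induced subgraphs on the balls, sending center to center and preserving the coloring. -/
def BallEquiv {V A : Type*} (T : SimpleGraph V) (φ : V → A) (n : ℕ) (x y : V) : Prop :=
  ∃ f : {v : V // T.dist x v ≤ n} ≃ {v : V // T.dist y v ≤ n},
    ((f ⟨x, by simp [SimpleGraph.dist_self]⟩ : {v : V // T.dist y v ≤ n}) : V) = y ∧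
    (∀ u w : {v : V // T.dist x v ≤ n}, T.Adj (u : V) (w : V) ↔ T.Adj (f u : V) (f w : V)) ∧
    ∀ v : {v : V // T.dist x v ≤ n}, φ (f v : V) = φ (v : V)

/-- Two vertices are in the same class if a color-preserving automorphism of `T`
sends one to the other. -/
def SameClass {V A : Type*} (T : SimpleGraph V) (φ : V → A) (x y : V) : Prop :=
  ∃ g : V ≃ V, (∀ u w : V, T.Adj (g u) (g w) ↔ T.Adj u w) ∧ g x = y ∧ ∀ v, φ (g v) = φ v

/-- Subword complexity: the number of equivalence classes of colored `n`-balls. -/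
noncomputable def ballComplexity {V A : Type*} (T : SimpleGraph V) (φ : V → A) (n : ℕ) : ℕ :=
  Nat.card (Quot (BallEquiv T φ n))

/-- A coloring is periodic if it is invariant under a subgroup of the automorphism group
of `T` having finitely many orbits on vertices. -/
def IsPeriodicColoring {V A : Type*} (T : SimpleGraph V) (φ : V → A) : Prop :=
  ∃ Γ : Subgroup (Equiv.Perm V),
    (∀ γ ∈ Γ, ∀ u w : V, T.Adj (γ u) (γ w) ↔ T.Adj u w) ∧
    (∀ γ ∈ Γ, ∀ v, φ (γ v) = φ v) ∧
    Finite (Quot (fun x y : V => ∃ γ ∈ Γ, γ x = y))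

/-- The colored `n`-ball around `x` is special. -/
def IsSpecial {V A : Type*} (T : SimpleGraph V) (φ : V → A) (n : ℕ) (x : V) : Prop :=
  ∃ y z : V, BallEquiv T φ n x y ∧ BallEquiv T φ n x z ∧ ¬ BallEquiv T φ (n + 1) y z

/-- The type set of a vertex. -/
def TypeSet {V A : Type*} (T : SimpleGraph V) (φ : V → A) (x : V) : Set ℕ :=
  {n : ℕ | IsSpecial T φ n x}

/-- The maximal type of a vertex of bounded type (`-1` if the type set is empty). -/
noncomputable def maxType {V A : Type*} (T : SimpleGraph V) (φ : V → A) (x : V) : ℤ :=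
  sSup (insert (-1) ((fun n : ℕ => (n : ℤ)) '' TypeSet T φ x))

/-- The coloring is Sturmian if its subword complexity is `n + 2`. -/
def IsSturmian {V A : Type*} (T : SimpleGraph V) (φ : V → A) : Prop :=
  ∀ n : ℕ, ballComplexity T φ n = n + 2

/-- Eventually periodic coloring. -/
def IsEventuallyPeriodic {V A : Type*} (T : SimpleGraph V) (φ : V → A) : Prop :=
  ∃ K : Set V, K.Nonempty ∧ K.Finite ∧ (T.induce K).Connected ∧
    ∀ v : (Kᶜ : Set V), ∃ ψ : V → A, IsPeriodicColoring T ψ ∧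
      ∀ w : (Kᶜ : Set V), (T.induce (Kᶜ : Set V)).Reachable v w → ψ (w : V) = φ (w : V)

/-- The vertex set of the `n`-branch from `x` towards its neighbor `x'`. -/
def branchSet {V : Type*} (T : SimpleGraph V) (n : ℕ) (x x' : V) : Set V :=
  insert x {y : V | T.dist x y ≤ n ∧ T.dist y x' < T.dist y x}

/-- Equivalence of colored `n`-branches. -/
def BranchEquiv {V A : Type*} (T : SimpleGraph V) (φ : V → A) (n : ℕ)
    (x x' y y' : V) : Prop :=
  ∃ f : (branchSet T n x x') ≃ (branchSet T n y y'),
    ((f ⟨x, Set.mem_insert x _⟩ : (branchSet T n y y')) : V) = y ∧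
    (∀ u w : (branchSet T n x x'), T.Adj (u : V) (w : V) ↔ T.Adj (f u : V) (f w : V)) ∧
    ∀ v : (branchSet T n x x'), φ (f v : V) = φ (v : V)

/-- A coloring of `K` appears exactly once if the only connected subgraph of `T`
color-isomorphic to it is `K` itself. -/
def AppearsOnce {V A : Type*} (T : SimpleGraph V) (φ : V → A) (K : Set V) : Prop :=
  ∀ K' : Set V, (T.induce K').Connected →
    (∃ f : K ≃ K', (∀ u w : K, T.Adj (u : V) (w : V) ↔ T.Adj (f u : V) (f w : V)) ∧
      ∀ v : K, φ (f v : V) = φ (v : V)) → K' = K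

/-- In a tree, the neighbor of `v` that is closer to `x` is unique. -/
lemma eq_of_adj_of_dist_lt {V : Type*} {T : SimpleGraph V} (hT : T.IsTree) {x v p q : V}
    (hp : T.Adj p v) (hq : T.Adj q v) (hpd : T.dist x p < T.dist x v)
    (hqd : T.dist x q < T.dist x v) : p = q := by
  have key : ∀ a : V, T.Adj a v → T.dist x a < T.dist x v →
      ∃ P : T.Walk x v, P.IsPath ∧ P.penultimate = a := by
    intro a ha had
    obtain ⟨P, hP⟩ := hT.connected.exists_walk_length_eq_dist x a
    refine ⟨P.concat ha, Walk.isPath_of_length_eq_dist _ ?_, by simp⟩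
    have := hT.dist_eq_dist_add_one_of_adj x ha
    rw [Walk.length_concat]
    omega
  obtain ⟨P, hP, rfl⟩ := key p hp hpd
  obtain ⟨Q, hQ, rfl⟩ := key q hq hqd
  rw [(hT.existsUnique_path x v).unique hP hQ]

lemma exists_adj_dist_add_one_eq {V : Type*} {T : SimpleGraph V} (hT : T.Connected) {x v : V}
    (h : T.dist x v ≠ 0) : ∃ p, T.Adj p v ∧ T.dist x p + 1 = T.dist x v := by
  obtain ⟨P, hP⟩ := hT.exists_walk_length_eq_dist v x
  rw [dist_comm] at hP
  cases P with
  | nil => exact absurd hP.symm h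
  | @cons _ w _ hw P =>
    refine ⟨w, hw.symm, ?_⟩
    have h1 : T.dist x w ≤ P.length := dist_comm (G := T) ▸ dist_le P
    have h2 := hT.dist_triangle (u := x) (v := w) (w := v)
    rw [dist_eq_one_iff_adj.2 hw.symm] at h2
    rw [Walk.length_cons] at hP
    omega

/-- A relation is equitable if related vertices have neighborhoods in relation-preserving
bijection. -/
def IsEquitable {V : Type*} (T : SimpleGraph V) (r : V → V → Prop) : Prop :=
  ∀ v w, r v w → ∃ σ : V → V, Set.BijOn σ (T.neighborSet v) (T.neighborSet w) ∧
    ∀ u, T.Adj v u → r u (σ u)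

/-- The bijection between the neighborhoods can be prescribed at one neighbor. -/
lemma IsEquitable.exists_bijOn_apply_eq {V : Type*} {T : SimpleGraph V} {r : V → V → Prop}
    (hr : Equivalence r) (he : IsEquitable T r) {v w p q : V} (hvw : r v w) (hpq : r p q)
    (hp : T.Adj v p) (hq : T.Adj w q) :
    ∃ σ : V → V, Set.BijOn σ (T.neighborSet v) (T.neighborSet w) ∧
      (∀ u, T.Adj v u → r u (σ u)) ∧ σ p = q := by
  classical
  obtain ⟨σ, hσ, hσr⟩ := he v w hvw
  have hσp : T.Adj w (σ p) := hσ.mapsTo hp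
  refine ⟨Equiv.swap (σ p) q ∘ σ, Set.BijOn.comp (Set.BijOn.mk ?_ ?_ ?_) hσ, ?_, by simp⟩
  · intro u hu
    simp only [mem_neighborSet] at hu ⊢
    rw [Equiv.swap_apply_def]
    split_ifs <;> assumption
  · exact (Equiv.injective _).injOn
  · intro u hu
    refine ⟨Equiv.swap (σ p) q u, ?_, by simp⟩
    simp only [mem_neighborSet] at hu ⊢
    rw [Equiv.swap_apply_def]
    split_ifs <;> assumption
  · intro u hu
    have h1 := hσr u hu
    have h2 := hσr p hp
    simp only [Function.comp_apply]
    rw [Equiv.swap_apply_def]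
    split_ifs with h3 h4
    · exact hr.trans (h3 ▸ h1) (hr.trans (hr.symm h2) hpq)
    · exact hr.trans (h4 ▸ h1) (hr.trans (hr.symm hpq) h2)
    · exact h1

/-- `G` maps `x` to `y`, preserves `r` on the `m`-ball around `x`, and is locally bijective at the
vertices of distance less than `m` from `x`. -/
def IsPartialCover {V : Type*} (T : SimpleGraph V) (r : V → V → Prop) (x y : V) (m : ℕ)
    (G : V → V) : Prop :=
  G x = y ∧ (∀ v, T.dist x v ≤ m → r v (G v)) ∧
    ∀ v, T.dist x v < m → Set.BijOn G (T.neighborSet v) (T.neighborSet (G v))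

lemma IsPartialCover.exists_extension {V : Type*} {T : SimpleGraph V} (hT : T.IsTree)
    {r : V → V → Prop} (hr : Equivalence r) (he : IsEquitable T r) {x y : V} {m : ℕ} {G : V → V}
    (hG : IsPartialCover T r x y m G) :
    ∃ G', IsPartialCover T r x y (m + 1) G' ∧ ∀ v, T.dist x v ≤ m → G' v = G v := by
  classical
  obtain ⟨hGx, hGr, hGb⟩ := hG
  have hτ : ∀ v, ∃ τ : V → V, T.dist x v = m →
      Set.BijOn τ (T.neighborSet v) (T.neighborSet (G v)) ∧
      (∀ u, T.Adj v u → r u (τ u)) ∧ ∀ u, T.Adj v u → T.dist x u ≤ m → τ u = G u := by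
    intro v
    by_cases hv : T.dist x v = m
    · by_cases hm : m = 0
      · obtain ⟨τ, h1, h2⟩ := he v (G v) (hGr v hv.le)
        refine ⟨τ, fun _ => ⟨h1, h2, fun u hu hum => ?_⟩⟩
        have := hT.dist_ne_of_adj x hu
        omega
      · obtain ⟨p, hp, hpd⟩ := exists_adj_dist_add_one_eq hT.connected (x := x) (v := v) (by omega)
        obtain ⟨τ, h1, h2, h3⟩ := he.exists_bijOn_apply_eq hr (hGr v hv.le)
          (hGr p (by omega)) hp.symm ((hGb p (by omega)).mapsTo hp).symm
        refine ⟨τ, fun _ => ⟨h1, h2, fun u hu hum => ?_⟩⟩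
        have := hT.dist_ne_of_adj x hu
        rw [eq_of_adj_of_dist_lt hT hu.symm hp (x := x) (by omega) (by omega), h3]
    · exact ⟨id, fun h => absurd h hv⟩
  choose τ hτ using hτ
  have hpar : ∀ v, ∃ p, T.dist x v ≠ 0 → T.Adj p v ∧ T.dist x p + 1 = T.dist x v := by
    intro v
    by_cases hv : T.dist x v = 0
    · exact ⟨v, fun h => absurd hv h⟩
    · obtain ⟨p, hp⟩ := exists_adj_dist_add_one_eq hT.connected hv
      exact ⟨p, fun _ => hp⟩
  choose par hpar using hpar
  set G' : V → V := fun w => if T.dist x w ≤ m then G w else τ (par w) w with hG'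
  have hG'G : ∀ v, T.dist x v ≤ m → G' v = G v := fun v hv => by simp [hG', hv]
  refine ⟨G', ⟨?_, ?_, ?_⟩, hG'G⟩
  · rw [hG'G x (by simp), hGx]
  · intro v hv
    by_cases hvm : T.dist x v ≤ m
    · rw [hG'G v hvm]
      exact hGr v hvm
    · obtain ⟨h1, h2⟩ := hpar v (by omega)
      simp only [hG', if_neg hvm]
      exact (hτ (par v) (by omega)).2.1 v h1
  · intro v hv
    rw [hG'G v (by omega)]
    by_cases hvm : T.dist x v < m
    · refine (hGb v hvm).congr fun u hu => (hG'G u ?_).symm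
      have := hT.dist_eq_dist_add_one_of_adj x hu
      omega
    · obtain ⟨h1, h2, h3⟩ := hτ v (by omega)
      refine h1.congr fun u hu => ?_
      by_cases hum : T.dist x u ≤ m
      · rw [hG'G u hum, h3 u hu hum]
      · obtain ⟨h4, h5⟩ := hpar u (by omega)
        have := hT.dist_eq_dist_add_one_of_adj x hu
        simp only [hG', if_neg hum]
        rw [eq_of_adj_of_dist_lt hT h4 hu (x := x) (by omega) (by omega)]

lemma IsEquitable.exists_cover {V : Type*} {T : SimpleGraph V} (hT : T.IsTree)
    {r : V → V → Prop} (hr : Equivalence r) (he : IsEquitable T r) {x y : V} (hxy : r x y) :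
    ∃ F : V → V, F x = y ∧ (∀ v, r v (F v)) ∧
      ∀ v, Set.BijOn F (T.neighborSet v) (T.neighborSet (F v)) := by
  have h0 : IsPartialCover T r x y 0 (fun _ => y) := by
    refine ⟨rfl, fun v hv => ?_, fun v hv => absurd hv (by omega)⟩
    rwa [← (hT.connected.dist_eq_zero_iff).1 (Nat.le_zero.1 hv)]
  let S : ∀ m : ℕ, {G : V → V // IsPartialCover T r x y m G} := fun m =>
    Nat.rec ⟨_, h0⟩
      (fun m G => ⟨_, (G.2.exists_extension hT hr he).choose_spec.1⟩) m
  have hS : ∀ m v, T.dist x v ≤ m → (S (m + 1)).1 v = (S m).1 v := fun m =>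
    ((S m).2.exists_extension hT hr he).choose_spec.2
  have hS' : ∀ m v, T.dist x v ≤ m → (S m).1 v = (S (T.dist x v)).1 v := by
    intro m v h
    induction m, h using Nat.le_induction with
    | base => rfl
    | succ m h ih => rw [hS m v h, ih]
  refine ⟨fun v => (S (T.dist x v)).1 v, ?_, fun v => (S _).2.2.1 v le_rfl, fun v => ?_⟩
  · exact (S _).2.1
  · have := (S (T.dist x v + 1)).2.2.2 v (by omega)
    rw [hS _ v le_rfl] at this
    refine this.congr fun u hu => hS' _ u ?_
    have := hT.dist_eq_dist_add_one_of_adj x hu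
    omega

lemma bijective_of_bijOn_neighborSet {V : Type*} {T : SimpleGraph V} (hT : T.IsTree) {F : V → V}
    (hF : ∀ v, Set.BijOn F (T.neighborSet v) (T.neighborSet (F v))) : Function.Bijective F := by
  obtain ⟨x⟩ := hT.connected.nonempty
  have hadj : ∀ {u v}, T.Adj u v → T.Adj (F u) (F v) := fun h => (hF _).mapsTo h
  have hdist : ∀ m v, T.dist x v = m → T.dist (F x) (F v) = m := by
    intro m
    induction m using Nat.strong_induction_on with
    | _ m ih =>
      intro v hv
      by_cases hm : m = 0
      · rw [hm, hT.connected.dist_eq_zero_iff] at hv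
        simp [← hv, hm]
      · obtain ⟨p, hp, hpd⟩ := exists_adj_dist_add_one_eq hT.connected (x := x) (v := v) (by omega)
        have h1 := ih _ (by omega) p rfl
        rcases hT.dist_eq_dist_add_one_of_adj (F x) (hadj hp) with h | h
        · exfalso
          obtain ⟨q, hq, hqd⟩ := exists_adj_dist_add_one_eq hT.connected (x := x) (v := p) (by
            intro h0
            omega)
          have h2 := ih _ (by omega) q rfl
          have h3 := eq_of_adj_of_dist_lt hT (hadj hp.symm) (hadj hq) (x := F x)
            (by omega) (by omega)
          have h4 := (hF p).injOn hp hq.symm h3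
          subst h4
          omega
        · omega
  constructor
  · have : ∀ m u v, T.dist x u = m → F u = F v → u = v := by
      intro m
      induction m with
      | zero =>
        intro u v hu h
        have h1 := hdist _ u rfl
        have h2 := hdist _ v rfl
        rw [← h, h1, hu] at h2
        rw [hT.connected.dist_eq_zero_iff] at hu
        rw [← hu, (hT.connected.dist_eq_zero_iff).1 h2.symm]
      | succ m ih =>
        intro u v hu h
        have h1 := hdist _ u rfl
        have h2 := hdist _ v rfl
        rw [← h, h1] at h2
        obtain ⟨p, hp, hpd⟩ := exists_adj_dist_add_one_eq hT.connected (x := x) (v := u) (by omega)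
        obtain ⟨q, hq, hqd⟩ := exists_adj_dist_add_one_eq hT.connected (x := x) (v := v) (by omega)
        have h3 := hdist _ p rfl
        have h4 := hdist _ q rfl
        have h5 : F p = F q := eq_of_adj_of_dist_lt hT (hadj hp) (h ▸ hadj hq) (x := F x)
          (by omega) (by omega)
        obtain rfl := ih p q (by omega) h5
        exact (hF p).injOn hp hq h
    exact fun u v => this _ u v rfl
  · intro w
    obtain ⟨P⟩ := hT.connected w (F x)
    generalize hy : F x = y at P
    induction P with
    | nil => exact ⟨x, hy⟩
    | cons h P ih =>
      obtain ⟨u, rfl⟩ := ih hy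
      obtain ⟨v, -, hv⟩ := (hF u).surjOn h.symm
      exact ⟨v, hv⟩

/-- The color-preserving automorphisms of `T`. -/
def coloredAut {V A : Type*} (T : SimpleGraph V) (φ : V → A) : Subgroup (Equiv.Perm V) where
  carrier := {γ | (∀ u w, T.Adj (γ u) (γ w) ↔ T.Adj u w) ∧ ∀ v, φ (γ v) = φ v}
  mul_mem' := by
    rintro a b ⟨ha, ha'⟩ ⟨hb, hb'⟩
    exact ⟨by simp [ha, hb], by simp [ha', hb']⟩
  one_mem' := by simp
  inv_mem' := by
    rintro a ⟨ha, ha'⟩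
    refine ⟨fun u w => ?_, fun v => ?_⟩
    · rw [← ha]
      simp
    · rw [← ha']
      simp

/-- A coloring of a tree that is constant on the classes of an equitable equivalence relation with
finitely many classes is periodic. -/
lemma IsEquitable.isPeriodicColoring {V A : Type*} {T : SimpleGraph V} {φ : V → A}
    (hT : T.IsTree) {r : V → V → Prop} (hr : Equivalence r) (he : IsEquitable T r)
    (hφ : ∀ v w, r v w → φ v = φ w) [Finite (Quot r)] : IsPeriodicColoring T φ := by
  refine ⟨coloredAut T φ, fun γ hγ => hγ.1, fun γ hγ => hγ.2, ?_⟩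
  have hor : ∀ x y, r x y → ∃ γ ∈ coloredAut T φ, γ x = y := by
    intro x y hxy
    obtain ⟨F, hFx, hFr, hF⟩ := he.exists_cover hT hr hxy
    have hbij := bijective_of_bijOn_neighborSet hT hF
    refine ⟨Equiv.ofBijective F hbij, ⟨fun u w => ⟨fun h => ?_, fun h => (hF u).mapsTo h⟩,
      fun v => (hφ _ _ (hFr v)).symm⟩, hFx⟩
    obtain ⟨w', hw', h'⟩ := (hF u).surjOn h
    exact hbij.injective h' ▸ hw'
  refine Finite.of_surjective (Quot.map id hor) fun q => ?_
  induction q using Quot.ind with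
  | _ a => exact ⟨Quot.mk _ a, rfl⟩

lemma ballEquiv_iff {V A : Type*} {T : SimpleGraph V} {φ : V → A} {n : ℕ} {x y : V} :
    BallEquiv T φ n x y ↔ ∃ F G : V → V, F x = y ∧
      (∀ v, T.dist x v ≤ n → T.dist y (F v) ≤ n ∧ G (F v) = v) ∧
      (∀ v, T.dist y v ≤ n → T.dist x (G v) ≤ n ∧ F (G v) = v) ∧
      (∀ u w, T.dist x u ≤ n → T.dist x w ≤ n → (T.Adj u w ↔ T.Adj (F u) (F w))) ∧
      ∀ v, T.dist x v ≤ n → φ (F v) = φ v := by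
  classical
  constructor
  · rintro ⟨f, hfx, hadj, hφ⟩
    refine ⟨fun v => if h : T.dist x v ≤ n then f ⟨v, h⟩ else v,
      fun v => if h : T.dist y v ≤ n then f.symm ⟨v, h⟩ else v, ?_, ?_, ?_, ?_, ?_⟩
    · simpa using hfx
    · intro v hv
      simp [hv, (f ⟨v, hv⟩).2]
    · intro v hv
      simp [hv, (f.symm ⟨v, hv⟩).2]
    · intro u w hu hw
      simpa [hu, hw] using hadj ⟨u, hu⟩ ⟨w, hw⟩
    · intro v hv
      simpa [hv] using hφ ⟨v, hv⟩
  · rintro ⟨F, G, hx, hF, hG, hadj, hφ⟩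
    exact ⟨⟨fun v => ⟨F v, (hF v v.2).1⟩, fun v => ⟨G v, (hG v v.2).1⟩,
      fun v => Subtype.ext (hF v v.2).2, fun v => Subtype.ext (hG v v.2).2⟩, hx,
      fun u w => hadj u w u.2 w.2, fun v => hφ v v.2⟩

lemma BallEquiv.equivalence {V A : Type*} (T : SimpleGraph V) (φ : V → A) (n : ℕ) :
    Equivalence (BallEquiv T φ n) where
  refl x := ballEquiv_iff.2 ⟨id, id, by simp⟩
  symm := by
    intro x y h
    obtain ⟨F, G, hx, hF, hG, hadj, hφ⟩ := ballEquiv_iff.1 h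
    refine ballEquiv_iff.2 ⟨G, F, ?_, hG, hF, fun u w hu hw => ?_, fun v hv => ?_⟩
    · rw [← hx, (hF x (by simp)).2]
    · rw [hadj _ _ (hG u hu).1 (hG w hw).1, (hG u hu).2, (hG w hw).2]
    · rw [← hφ _ (hG v hv).1, (hG v hv).2]
  trans := by
    intro x y z h h'
    obtain ⟨F, G, hx, hF, hG, hadj, hφ⟩ := ballEquiv_iff.1 h
    obtain ⟨F', G', hx', hF', hG', hadj', hφ'⟩ := ballEquiv_iff.1 h'
    refine ballEquiv_iff.2 ⟨F' ∘ F, G ∘ G', by simp [hx, hx'], fun v hv => ?_, fun v hv => ?_,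
      fun u w hu hw => ?_, fun v hv => ?_⟩
    · have h1 := hF v hv
      have h2 := hF' _ h1.1
      exact ⟨h2.1, by simp [h2.2, h1.2]⟩
    · have h1 := hG' v hv
      have h2 := hG _ h1.1
      exact ⟨h2.1, by simp [h2.2, h1.2]⟩
    · rw [hadj u w hu hw, hadj' _ _ (hF u hu).1 (hF w hw).1]
      rfl
    · rw [← hφ v hv, ← hφ' _ (hF v hv).1]
      rfl

lemma BallEquiv.color_eq {V A : Type*} {T : SimpleGraph V} {φ : V → A} {n : ℕ} {x y : V}
    (h : BallEquiv T φ n x y) : φ x = φ y := by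
  obtain ⟨F, G, rfl, hF, hG, hadj, hφ⟩ := ballEquiv_iff.1 h
  exact (hφ x (by simp)).symm

/-- A map preserving adjacency on the `n`-ball around `u` does not increase distances from `u`
within this ball. -/
lemma dist_map_le {V : Type*} {T : SimpleGraph V} (hT : T.Connected) {F : V → V} {B : Set V}
    (hF : ∀ v ∈ B, ∀ w ∈ B, T.Adj v w → T.Adj (F v) (F w)) {u : V} {n : ℕ}
    (hB : ∀ w, T.dist u w ≤ n → w ∈ B) {w : V} (hw : T.dist u w ≤ n) :
    T.dist (F u) (F w) ≤ T.dist u w := by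
  induction hm : T.dist u w generalizing w with
  | zero => simp [(hT.dist_eq_zero_iff).1 hm]
  | succ m ih =>
    obtain ⟨p, hp, hpd⟩ := exists_adj_dist_add_one_eq hT (x := u) (v := w) (by omega)
    have h1 := ih (w := p) (by omega) (by omega)
    have h2 := hF p (hB p (by omega)) w (hB w hw) hp
    have h3 := hT.dist_triangle (u := F u) (v := F p) (w := F w)
    rw [dist_eq_one_iff_adj.2 h2] at h3
    omega

/-- An equivalence of `(n + 1)`-balls matches neighbors of the centers with equivalent `n`-balls. -/
lemma BallEquiv.exists_bijOn_neighborSet {V A : Type*} {T : SimpleGraph V} (hT : T.Connected)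
    {φ : V → A} {n : ℕ} {x y : V} (h : BallEquiv T φ (n + 1) x y) :
    ∃ σ : V → V, Set.BijOn σ (T.neighborSet x) (T.neighborSet y) ∧
      (∀ u, T.Adj x u → BallEquiv T φ n u (σ u)) ∧ BallEquiv T φ n x y := by
  obtain ⟨F, G, rfl, hF, hG, hadj, hφ⟩ := ballEquiv_iff.1 h
  have hx : T.dist x x ≤ n + 1 := by simp
  have hGx := (hF x hx).2
  have hball : ∀ {a b}, T.Adj a b → T.dist a b ≤ n + 1 := fun h => by
    rw [dist_eq_one_iff_adj.2 h]
    omega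
  have hadjG : ∀ u, T.dist (F x) u ≤ n + 1 → ∀ w, T.dist (F x) w ≤ n + 1 →
      T.Adj u w → T.Adj (G u) (G w) := by
    intro u hu w hw h
    rwa [hadj _ _ (hG u hu).1 (hG w hw).1, (hG u hu).2, (hG w hw).2]
  have restrict : ∀ u, T.dist x u ≤ n + 1 → (∀ w, T.dist u w ≤ n → T.dist x w ≤ n + 1) →
      (∀ w, T.dist (F u) w ≤ n → T.dist (F x) w ≤ n + 1) → BallEquiv T φ n u (F u) := by
    intro u hu h1 h2
    refine ballEquiv_iff.2 ⟨F, G, rfl, fun v hv => ⟨?_, (hF v (h1 v hv)).2⟩,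
      fun v hv => ⟨?_, (hG v (h2 v hv)).2⟩, fun v w hv hw => hadj v w (h1 v hv) (h1 w hw),
      fun v hv => hφ v (h1 v hv)⟩
    · exact (dist_map_le hT (B := {w | T.dist x w ≤ n + 1})
        (fun v hv w hw h => (hadj v w hv hw).1 h) h1 hv).trans hv
    · have := dist_map_le hT (B := {w | T.dist (F x) w ≤ n + 1}) hadjG h2 hv
      rw [(hF u hu).2] at this
      exact this.trans hv
  have near : ∀ {a b c}, T.Adj a b → T.dist b c ≤ n → T.dist a c ≤ n + 1 := by
    intro a b c h h'
    have := hT.dist_triangle (u := a) (v := b) (w := c)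
    rw [dist_eq_one_iff_adj.2 h] at this
    omega
  have hmap : ∀ u, T.Adj x u → T.Adj (F x) (F u) := fun u hu => (hadj x u hx (hball hu)).1 hu
  refine ⟨F, ⟨hmap, fun u hu w hw h => ?_, fun w hw => ?_⟩, fun u hu => ?_, ?_⟩
  · rw [← (hF u (hball hu)).2, h, (hF w (hball hw)).2]
  · refine ⟨G w, ?_, (hG w (hball hw)).2⟩
    have := hadjG (F x) (by simp) w (hball hw) hw
    rwa [hGx] at this
  · exact restrict u (hball hu) (fun w => near hu) (fun w => near (hmap u hu))
  · exact restrict x hx (fun w hw => by omega) (fun w hw => by omega)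

theorem stmt_2 {V A : Type*} (T : SimpleGraph V) (φ : V → A) (k : ℕ)
    (hk : 2 ≤ k) (htree : T.IsTree) (hreg : ∀ v : V, (T.neighborSet v).ncard = k)
    (hnp : ¬ IsPeriodicColoring T φ) (n : ℕ) :
    ∃ f : Fin (n + 2) → V, ∀ i j : Fin (n + 2), BallEquiv T φ n (f i) (f j) → i = j := by
  classical
  induction n with
  | zero =>
    obtain ⟨a, b, hab⟩ : ∃ a b, φ a ≠ φ b := by
      by_contra! hφ
      have : Subsingleton (Quot fun _ _ : V => True) :=
        ⟨by rintro ⟨a⟩ ⟨b⟩; exact Quot.sound trivial⟩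
      refine hnp (IsEquitable.isPeriodicColoring htree (r := fun _ _ => True)
        ⟨fun _ => trivial, fun _ => trivial, fun _ _ => trivial⟩ ?_ fun v w _ => hφ v w)
      intro v w _
      have hfin : ∀ v, (T.neighborSet v).Finite := fun v =>
        Set.finite_of_ncard_ne_zero (by rw [hreg]; omega)
      obtain ⟨e⟩ : Nonempty (T.neighborSet v ≃ T.neighborSet w) := by
        have := (hfin v).to_subtype
        have := (hfin w).to_subtype
        exact Finite.card_eq.1 ((hreg v).trans (hreg w).symm)
      refine ⟨fun u => if h : u ∈ T.neighborSet v then e ⟨u, h⟩ else u,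
        ⟨fun u hu => ?_, fun u hu u' hu' h => ?_, fun u hu => ?_⟩, fun _ _ => trivial⟩
      · simp only [dif_pos hu]
        exact (e ⟨u, hu⟩).2
      · simp only [dif_pos hu, dif_pos hu'] at h
        exact congrArg Subtype.val (e.injective (Subtype.ext h))
      · refine ⟨e.symm ⟨u, hu⟩, (e.symm ⟨u, hu⟩).2, ?_⟩
        simp only [dif_pos (e.symm ⟨u, hu⟩).2, Subtype.coe_eta, Equiv.apply_symm_apply]
    refine ⟨![a, b], fun i j h => ?_⟩
    have h := h.color_eq
    fin_cases i <;> fin_cases j <;> simp_all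
  | succ n ih =>
    obtain ⟨f, hf⟩ := ih
    have hmono : ∀ {v w}, BallEquiv T φ (n + 1) v w → BallEquiv T φ n v w := fun h =>
      (h.exists_bijOn_neighborSet htree.connected).choose_spec.2.2
    have hr := BallEquiv.equivalence T φ (n + 1)
    obtain ⟨z, hz⟩ : ∃ z, ∀ i, ¬ BallEquiv T φ (n + 1) (f i) z := by
      by_contra! hall
      have hup : ∀ v w, BallEquiv T φ n v w → BallEquiv T φ (n + 1) v w := by
        intro v w h
        obtain ⟨i, hi⟩ := hall v
        obtain ⟨j, hj⟩ := hall w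
        have hn := BallEquiv.equivalence T φ n
        obtain rfl := hf i j (hn.trans (hmono hi) (hn.trans h (hn.symm (hmono hj))))
        exact hr.trans (hr.symm hi) hj
      have : Finite (Quot (BallEquiv T φ (n + 1))) := by
        refine Finite.of_surjective (fun i => Quot.mk _ (f i)) fun q => ?_
        induction q using Quot.ind with
        | _ a =>
          obtain ⟨i, hi⟩ := hall a
          exact ⟨i, Quot.sound hi⟩
      refine hnp (IsEquitable.isPeriodicColoring htree hr ?_ fun v w h => h.color_eq)
      intro v w h
      obtain ⟨σ, h1, h2, -⟩ := h.exists_bijOn_neighborSet htree.connected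
      exact ⟨σ, h1, fun u hu => hup _ _ (h2 u hu)⟩
    refine ⟨Fin.cons z f, fun i j => ?_⟩
    refine Fin.cases ?_ (fun i => ?_) i <;> refine Fin.cases ?_ (fun j => ?_) j
    · exact fun _ => rfl
    · exact fun h => absurd (hr.symm h) (hz j)
    · exact fun h => absurd h (hz i)
    · exact fun h => congrArg Fin.succ (hf i j (hmono h))
end

section
/- Suppose φ is Sturmian and of bounded type (every vertex has a finite type set). If two vertices x and y satisfy τ(x) = τ(y), then x and y are in the same class. -/
open SimpleGraph

section TreeAutomorphism

variable {V : Type*} {T : SimpleGraph V}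

/-- In a tree, a vertex has at most one neighbor closer to a given root. -/
theorem SimpleGraph.IsTree.eq_of_adj_of_dist_lt (hT : T.IsTree) {r u a b : V}
    (ha : T.Adj u a) (hb : T.Adj u b) (hda : T.dist r a < T.dist r u)
    (hdb : T.dist r b < T.dist r u) : a = b := by
  obtain ⟨p, hp, -⟩ := hT.connected.exists_path_of_dist r u
  have key : ∀ c, T.Adj u c → T.dist r c < T.dist r u → c = p.penultimate := by
    intro c hc hdc
    refine hT.isAcyclic.eq_penultimate_of_adj_end hp hc ?_
    obtain ⟨q, hq, hql⟩ := hT.connected.exists_path_of_dist r c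
    refine hT.isAcyclic.mem_support_of_ne_mem_support_of_adj_of_isPath hp hq hc ?_
    intro hu
    obtain ⟨q₀, q₁, rfl⟩ := Walk.mem_support_iff_exists_append.mp hu
    have := T.dist_le q₀
    rw [Walk.length_append] at hql
    omega
  rw [key a ha hda, key b hb hdb]

theorem SimpleGraph.IsTree.exists_adj_dist_add_one (hT : T.IsTree) {r v : V} (hv : v ≠ r) :
    ∃ p, T.Adj v p ∧ T.dist r v = T.dist r p + 1 := by
  obtain ⟨q, hq⟩ := (hT.connected v r).exists_walk_length_eq_dist
  cases q with
  | nil => exact absurd rfl hv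
  | cons hadj q =>
    refine ⟨_, hadj, ?_⟩
    have h1 := T.dist_le q
    rw [Walk.length_cons, dist_comm] at hq
    rw [dist_comm] at h1
    rcases hT.dist_eq_dist_add_one_of_adj r hadj with h | h <;> omega

/-- A partial automorphism of `T` respecting the relations `R`, defined on the ball of
radius `n` around `x`. -/
structure IsPartialAut (T : SimpleGraph V) (R : ℕ → V → V → Prop) (x y : V) (n : ℕ)
    (f : V → V) : Prop where
  map_root : f x = y
  rel : ∀ v, T.dist x v ≤ n → R (T.dist x v) v (f v)
  dist_map : ∀ v, T.dist x v ≤ n → T.dist y (f v) = T.dist x v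
  bijOn : ∀ v, T.dist x v < n → Set.BijOn f (T.neighborSet v) (T.neighborSet (f v))

theorem exists_bijOn_of_equiv {α : Type*} {s t : Set α} (σ : s ≃ t) :
    ∃ f : α → α, Set.BijOn f s t ∧ ∀ a : s, f a = σ a := by
  classical
  refine ⟨fun a => if h : a ∈ s then σ ⟨a, h⟩ else a, ⟨?_, ?_, ?_⟩, ?_⟩
  · intro a ha
    simp [ha]
  · intro a ha b hb hab
    simp only [ha, hb, dif_pos] at hab
    simpa using σ.injective (Subtype.ext hab)
  · intro b hb
    refine ⟨σ.symm ⟨b, hb⟩, (σ.symm ⟨b, hb⟩).2, by simp⟩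
  · intro a
    simp

/-- A relation with suitable bijections between neighborhoods extends a partial
automorphism by one more layer. -/
theorem IsPartialAut.extend (hT : T.IsTree) {R : ℕ → V → V → Prop} {x y : V}
    (hroot : ∃ σ : T.neighborSet x ≃ T.neighborSet y, ∀ a : T.neighborSet x, R 1 a (σ a))
    (hstep : ∀ d u w p q (hp : T.Adj u p) (hq : T.Adj w q), R d p q → R (d + 1) u w →
      ∃ σ : T.neighborSet u ≃ T.neighborSet w, σ ⟨p, hp⟩ = ⟨q, hq⟩ ∧
        ∀ a : T.neighborSet u, (a : V) ≠ p → R (d + 2) a (σ a))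
    {n : ℕ} {f : V → V} (hf : IsPartialAut T R x y n f) :
    ∃ f' : V → V, IsPartialAut T R x y (n + 1) f' ∧ ∀ v, T.dist x v ≤ n → f' v = f v := by
  classical
  have hs : ∀ u, T.dist x u = n → ∃ s : V → V,
      Set.BijOn s (T.neighborSet u) (T.neighborSet (f u)) ∧
      (∀ a, T.Adj u a → T.dist x a ≤ n → s a = f a) ∧
      ∀ a, T.Adj u a → T.dist x a = n + 1 → R (n + 1) a (s a) ∧ T.dist y (s a) = n + 1 := by
    intro u hu
    by_cases hux : u = x
    · subst hux
      rw [SimpleGraph.dist_self] at hu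
      subst hu
      obtain ⟨σ, hσ⟩ := hroot
      obtain ⟨s, hsb, hsσ⟩ := exists_bijOn_of_equiv σ
      rw [hf.map_root]
      refine ⟨s, hsb, ?_, ?_⟩
      · intro a ha hda
        rw [← dist_eq_one_iff_adj] at ha
        omega
      · intro a ha _
        refine ⟨?_, dist_eq_one_iff_adj.mpr (hsb.mapsTo ha)⟩
        rw [hsσ ⟨a, ha⟩]
        exact hσ ⟨a, ha⟩
    · obtain ⟨p, hup, hdp⟩ := hT.exists_adj_dist_add_one hux
      have hpb := hf.bijOn p (by omega)
      have hq : T.Adj (f u) (f p) := (hpb.mapsTo hup.symm : T.Adj (f p) (f u)).symm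
      have hRp := hf.rel p (by omega)
      have hRu := hf.rel u (by omega)
      rw [hdp] at hRu
      obtain ⟨σ, hσp, hσ⟩ := hstep _ _ _ _ _ hup hq hRp hRu
      obtain ⟨s, hsb, hsσ⟩ := exists_bijOn_of_equiv σ
      have hsp : s p = f p := by rw [hsσ ⟨p, hup⟩, hσp]
      refine ⟨s, hsb, ?_, ?_⟩
      · intro a ha hda
        have hap : a = p := by
          refine hT.eq_of_adj_of_dist_lt (r := x) ha hup ?_ (by omega)
          rcases hT.dist_eq_dist_add_one_of_adj x ha with h | h <;> omega
        rw [hap, hsp]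
      · intro a ha hda
        have hap : a ≠ p := by
          rintro rfl
          omega
        refine ⟨?_, ?_⟩
        · have := hσ ⟨a, ha⟩ hap
          rw [← hsσ] at this
          rwa [show n + 1 = T.dist x p + 2 by omega]
        · have hsa : T.Adj (f u) (s a) := hsb.mapsTo ha
          have hne : s a ≠ f p := fun h => hap (hsb.injOn ha hup (h.trans hsp.symm))
          have hdu := hf.dist_map u (by omega)
          have hdfp := hf.dist_map p (by omega)
          rcases hT.dist_eq_dist_add_one_of_adj y hsa with h | h
          · exact absurd (hT.eq_of_adj_of_dist_lt (r := y) hsa hq (by omega) (by omega)) hne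
          · omega
  choose! s hsb hsf hsR using hs
  have hpar : ∀ v, T.dist x v = n + 1 → ∃ p, T.Adj v p ∧ T.dist x p = n := by
    intro v hv
    obtain ⟨p, hp, hd⟩ := hT.exists_adj_dist_add_one (r := x) (v := v) (by
      rintro rfl
      simp at hv)
    exact ⟨p, hp, by omega⟩
  choose! par hpar hdpar using hpar
  let f' : V → V := fun v => if T.dist x v = n + 1 then s (par v) v else f v
  have hold : ∀ v, T.dist x v ≤ n → f' v = f v := fun v hv => if_neg (by omega)
  have hnew : ∀ v, T.dist x v = n + 1 → f' v = s (par v) v := fun v hv => if_pos hv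
  refine ⟨f', ⟨?_, ?_, ?_, ?_⟩, hold⟩
  · rw [hold x (by simp), hf.map_root]
  · intro v hv
    rcases Nat.lt_or_ge (T.dist x v) (n + 1) with h | h
    · rw [hold v (by omega)]
      exact hf.rel v (by omega)
    · have h : T.dist x v = n + 1 := by omega
      rw [hnew v h, h]
      exact (hsR _ (hdpar v h) v (hpar v h).symm h).1
  · intro v hv
    rcases Nat.lt_or_ge (T.dist x v) (n + 1) with h | h
    · rw [hold v (by omega)]
      exact hf.dist_map v (by omega)
    · have h : T.dist x v = n + 1 := by omega
      rw [hnew v h, h]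
      exact (hsR _ (hdpar v h) v (hpar v h).symm h).2
  · intro u hu
    rw [hold u (by omega)]
    rcases Nat.lt_or_ge (T.dist x u) n with h | h
    · refine (hf.bijOn u h).congr fun a ha => (hold a ?_).symm
      rcases hT.dist_eq_dist_add_one_of_adj x (show T.Adj u a from ha) with h | h <;> omega
    · have h : T.dist x u = n := by omega
      refine (hsb u h).congr fun a ha => ?_
      replace ha : T.Adj u a := ha
      rcases hT.dist_eq_dist_add_one_of_adj x ha with h' | h'
      · rw [hold a (by omega), hsf u h a ha (by omega)]
      · have hda : T.dist x a = n + 1 := by omega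
        have := hdpar a hda
        rw [hnew a hda, hT.eq_of_adj_of_dist_lt (r := x) (hpar a hda) ha.symm
          (by omega) (by omega)]

/-- A map that is bijective on neighborhoods and preserves distances to a root is an
automorphism of the tree. -/
theorem exists_aut_of_bijOn_neighborSet (hT : T.IsTree) {x y : V} {g : V → V} (hgx : g x = y)
    (hdist : ∀ v, T.dist y (g v) = T.dist x v)
    (hbij : ∀ v, Set.BijOn g (T.neighborSet v) (T.neighborSet (g v))) :
    ∃ e : V ≃ V, (∀ u w, T.Adj (e u) (e w) ↔ T.Adj u w) ∧ ∀ v, e v = g v := by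
  have hadj : ∀ {u w}, T.Adj u w → T.Adj (g u) (g w) := fun {u w} h => (hbij u).mapsTo h
  have hinj : ∀ n u w, T.dist x u = n → g u = g w → u = w := by
    intro n
    induction n with
    | zero =>
      intro u w hu huw
      have hw : T.dist x w = 0 := by rw [← hdist, ← huw, hdist, hu]
      rw [hT.connected.dist_eq_zero_iff] at hu hw
      rw [← hu, ← hw]
    | succ n ih =>
      intro u w hu huw
      have hw : T.dist x w = n + 1 := by rw [← hdist, ← huw, hdist, hu]
      obtain ⟨p, hp, hdp⟩ := hT.exists_adj_dist_add_one (r := x) (v := u) (by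
        rintro rfl
        simp at hu)
      obtain ⟨q, hq, hdq⟩ := hT.exists_adj_dist_add_one (r := x) (v := w) (by
        rintro rfl
        simp at hw)
      have hpq : g p = g q := by
        refine hT.eq_of_adj_of_dist_lt (r := y) (u := g u) (hadj hp) (huw ▸ hadj hq) ?_ ?_ <;>
        · rw [hdist, hdist]
          omega
      obtain rfl := ih p q (by omega) hpq
      exact (hbij p).injOn hp.symm hq.symm huw
  have hinj' : Function.Injective g := fun u w h => hinj _ u w rfl h
  have hsurj : ∀ n w, T.dist y w = n → ∃ v, g v = w := by
    intro n
    induction n with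
    | zero =>
      intro w hw
      rw [hT.connected.dist_eq_zero_iff] at hw
      exact ⟨x, hgx.trans hw⟩
    | succ n ih =>
      intro w hw
      obtain ⟨q, hq, hdq⟩ := hT.exists_adj_dist_add_one (r := y) (v := w) (by
        rintro rfl
        simp at hw)
      obtain ⟨p, rfl⟩ := ih q (by omega)
      obtain ⟨v, -, hv⟩ := (hbij p).surjOn hq.symm
      exact ⟨v, hv⟩
  refine ⟨Equiv.ofBijective g ⟨hinj', fun w => hsurj _ w rfl⟩, ?_, fun v => rfl⟩
  intro u w
  refine ⟨fun h => ?_, fun h => hadj h⟩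
  obtain ⟨w', hw', heq⟩ := (hbij u).surjOn h
  exact hinj' heq ▸ hw'

/-- Building an automorphism of a tree from compatible bijections between neighborhoods. -/
theorem exists_aut_of_neighborSet_equiv (hT : T.IsTree) {R : ℕ → V → V → Prop} {x y : V}
    (h0 : R 0 x y)
    (hroot : ∃ σ : T.neighborSet x ≃ T.neighborSet y, ∀ a : T.neighborSet x, R 1 a (σ a))
    (hstep : ∀ d u w p q (hp : T.Adj u p) (hq : T.Adj w q), R d p q → R (d + 1) u w →
      ∃ σ : T.neighborSet u ≃ T.neighborSet w, σ ⟨p, hp⟩ = ⟨q, hq⟩ ∧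
        ∀ a : T.neighborSet u, (a : V) ≠ p → R (d + 2) a (σ a)) :
    ∃ g : V ≃ V, (∀ u w, T.Adj (g u) (g w) ↔ T.Adj u w) ∧ g x = y ∧
      (∀ v, T.dist y (g v) = T.dist x v) ∧ ∀ v, R (T.dist x v) v (g v) := by
  have hbase : IsPartialAut T R x y 0 (fun _ => y) := by
    refine ⟨rfl, ?_, ?_, by simp⟩ <;>
    · intro v hv
      obtain rfl := hT.connected.dist_eq_zero_iff.mp (Nat.le_zero.mp hv)
      simp [h0]
  choose! next hnext hagree using fun n f =>
    IsPartialAut.extend (n := n) (f := f) hT hroot hstep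
  let F : ℕ → V → V := fun n => Nat.rec (fun _ => y) next n
  have hF : ∀ n, IsPartialAut T R x y n (F n) := by
    intro n
    induction n with
    | zero => exact hbase
    | succ n ih => exact hnext n _ ih
  have hFle : ∀ v n, T.dist x v ≤ n → F n v = F (T.dist x v) v := by
    intro v n hn
    induction n, hn using Nat.le_induction with
    | base => rfl
    | succ n hn ih => rw [← ih]; exact hagree n _ (hF n) v hn
  have hdist : ∀ v, T.dist y (F (T.dist x v) v) = T.dist x v := fun v =>
    (hF _).dist_map v le_rfl
  have hx : F (T.dist x x) x = y := (hF _).map_root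
  obtain ⟨e, hadj, he⟩ := exists_aut_of_bijOn_neighborSet hT (g := fun v => F (T.dist x v) v)
    hx hdist (by
      intro v
      have h := (hF (T.dist x v + 1)).bijOn v (by omega)
      simp only [hFle v (T.dist x v + 1) (by omega)] at h
      refine h.congr fun a ha => hFle a (T.dist x v + 1) ?_
      rcases hT.dist_eq_dist_add_one_of_adj x (show T.Adj v a from ha) with h | h <;> omega)
  refine ⟨e, hadj, (he x).trans hx, fun v => ?_, fun v => ?_⟩
  · rw [he]
    exact hdist v
  · rw [he]
    exact (hF _).rel v le_rfl

end TreeAutomorphism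

section ColorRefinement

variable {V A : Type*} {T : SimpleGraph V} {φ : V → A}

/-- The `n`-th step of color refinement: vertices are equivalent if they are equivalent at the
previous step and their neighbors can be matched up to the previous equivalence. -/
def RefineEquiv (T : SimpleGraph V) (φ : V → A) : ℕ → V → V → Prop
  | 0, x, y => φ x = φ y
  | n + 1, x, y => RefineEquiv T φ n x y ∧
      ∃ σ : T.neighborSet x ≃ T.neighborSet y, ∀ a : T.neighborSet x, RefineEquiv T φ n a (σ a)

/-- Vertices that no step of color refinement distinguishes. -/
def StableEquiv (T : SimpleGraph V) (φ : V → A) (x y : V) : Prop :=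
  ∀ n, RefineEquiv T φ n x y

theorem refineEquiv_equivalence (T : SimpleGraph V) (φ : V → A) (n : ℕ) :
    Equivalence (RefineEquiv T φ n) := by
  induction n with
  | zero => exact ⟨fun _ => rfl, fun h => Eq.symm h, fun h h' => Eq.trans h h'⟩
  | succ n ih =>
    refine ⟨fun x => ⟨ih.refl x, Equiv.refl _, fun a => ih.refl _⟩, ?_, ?_⟩
    · rintro x y ⟨h, σ, hσ⟩
      refine ⟨ih.symm h, σ.symm, fun a => ih.symm ?_⟩
      simpa using hσ (σ.symm a)
    · rintro x y z ⟨h, σ, hσ⟩ ⟨h', τ, hτ⟩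
      exact ⟨ih.trans h h', σ.trans τ, fun a => ih.trans (hσ a) (hτ (σ a))⟩

theorem stableEquiv_equivalence (T : SimpleGraph V) (φ : V → A) :
    Equivalence (StableEquiv T φ) :=
  ⟨fun x n => (refineEquiv_equivalence T φ n).refl x,
    fun h n => (refineEquiv_equivalence T φ n).symm (h n),
    fun h h' n => (refineEquiv_equivalence T φ n).trans (h n) (h' n)⟩

theorem RefineEquiv.mono {m n : ℕ} (hmn : m ≤ n) {x y : V} (h : RefineEquiv T φ n x y) :
    RefineEquiv T φ m x y := by
  induction n, hmn using Nat.le_induction with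
  | base => exact h
  | succ n _ ih => exact ih h.1

/-- A bijection respecting an equivalence relation can be modified to send a given element
to a given equivalent one. -/
theorem Equivalence.exists_equiv_apply_eq {α : Type*} {r : α → α → Prop} (hr : Equivalence r)
    {s t : Set α} (σ : s ≃ t) (hσ : ∀ a : s, r a (σ a)) (p : s) (q : t) (hpq : r p q) :
    ∃ τ : s ≃ t, τ p = q ∧ ∀ a : s, r a (τ a) := by
  classical
  refine ⟨σ.trans (Equiv.swap (σ p) q), by simp, fun a => ?_⟩
  rw [Equiv.trans_apply, Equiv.swap_apply_def]
  split_ifs with h1 h2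
  · rw [σ.injective h1]
    exact hpq
  · have := hσ a
    rw [h2] at this
    exact hr.trans this (hr.trans (hr.symm hpq) (hσ p))
  · exact hσ a

theorem RefineEquiv.ballEquiv (hT : T.IsTree)
    (hreg : ∀ u w : V, Nonempty (T.neighborSet u ≃ T.neighborSet w))
    {n : ℕ} {x y : V} (h : RefineEquiv T φ n x y) : BallEquiv T φ n x y := by
  obtain ⟨g, hadj, hgx, hdist, hg⟩ := exists_aut_of_neighborSet_equiv hT
    (R := fun d u w => d ≤ n → RefineEquiv T φ (n - d) u w) (x := x) (y := y)
    (fun _ => h)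
    (by
      cases n with
      | zero =>
        obtain ⟨σ⟩ := hreg x y
        exact ⟨σ, fun a ha => by omega⟩
      | succ n =>
        obtain ⟨-, σ, hσ⟩ := h
        exact ⟨σ, fun a _ => hσ a⟩)
    (by
      intro d u w p q hp hq hpq huw
      have hr := refineEquiv_equivalence T φ (n - (d + 2))
      by_cases hd : d + 2 ≤ n
      · have huw := huw (by omega)
        rw [show n - (d + 1) = n - (d + 2) + 1 by omega] at huw
        obtain ⟨-, σ, hσ⟩ := huw
        obtain ⟨τ, hτ, hτr⟩ := hr.exists_equiv_apply_eq σ hσ ⟨p, hp⟩ ⟨q, hq⟩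
          ((hpq (by omega)).mono (by omega))
        exact ⟨τ, hτ, fun a _ _ => hτr a⟩
      · classical
        obtain ⟨σ⟩ := hreg u w
        exact ⟨σ.trans (Equiv.swap (σ ⟨p, hp⟩) ⟨q, hq⟩), by simp, fun a _ h => by omega⟩)
  refine ⟨g.subtypeEquiv fun v => by rw [hdist], hgx, fun u w => (hadj u w).symm, ?_⟩
  intro v
  exact ((hg v v.2).mono (Nat.zero_le _) : φ (v : V) = φ (g v)).symm

theorem BallEquiv.refineEquiv (hconn : T.Connected) {k : ℕ}
    (hfin : ∀ v : V, (T.neighborSet v).Finite) (hreg : ∀ v : V, (T.neighborSet v).ncard = k)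
    {n : ℕ} {x y : V} (h : BallEquiv T φ n x y) : RefineEquiv T φ n x y := by
  obtain ⟨f, hfx, hadj, hφ⟩ := h
  have key : ∀ j v (hv : T.dist x v + j ≤ n),
      RefineEquiv T φ j v (f ⟨v, by omega⟩ : V) := by
    intro j
    induction j with
    | zero => intro v hv; exact (hφ ⟨v, by omega⟩).symm
    | succ j ih =>
      intro v hv
      refine ⟨ih v (by omega), ?_⟩
      have hd : ∀ a : T.neighborSet v, T.dist x a ≤ T.dist x v + 1 := by
        intro a
        have := hconn.dist_triangle (u := x) (v := v) (w := a)
        rwa [dist_eq_one_iff_adj.mpr a.2] at this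
      let s : T.neighborSet v → T.neighborSet (f ⟨v, by omega⟩ : V) := fun a =>
        ⟨f ⟨a, by have := hd a; omega⟩, (hadj ⟨v, by omega⟩ ⟨a, _⟩).mp a.2⟩
      have hs : Function.Injective s := by
        intro a b hab
        have := f.injective (Subtype.ext (Subtype.mk.inj hab))
        exact Subtype.ext (Subtype.mk.inj this)
      have := (hfin v).to_subtype
      have := (hfin (f ⟨v, by omega⟩ : V)).to_subtype
      have hcard : Nat.card (T.neighborSet v) =
          Nat.card (T.neighborSet (f ⟨v, by omega⟩ : V)) := by
        rw [Nat.card_coe_set_eq, Nat.card_coe_set_eq, hreg, hreg]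
      exact ⟨Equiv.ofBijective s ((Nat.bijective_iff_injective_and_card s).mpr ⟨hs, hcard⟩),
        fun a => ih a (by have := hd a; omega)⟩
  have := key n x (by simp)
  rwa [hfx] at this

/-- Stably equivalent vertices have neighborhoods matched up to stable equivalence. -/
theorem StableEquiv.exists_equiv (hfin : ∀ v : V, (T.neighborSet v).Finite) {x y : V}
    (h : StableEquiv T φ x y) :
    ∃ σ : T.neighborSet x ≃ T.neighborSet y, ∀ a : T.neighborSet x, StableEquiv T φ a (σ a) := by
  have := (hfin x).to_subtype
  have := (hfin y).to_subtype
  choose σ hσ using fun n => (h (n + 1)).2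
  obtain ⟨τ, hτ⟩ := Finite.exists_infinite_fiber σ
  refine ⟨τ, fun a n => ?_⟩
  obtain ⟨m, hm, hnm⟩ := (Set.infinite_coe_iff.mp hτ).exists_gt n
  obtain rfl : σ m = τ := hm
  exact (hσ m a).mono hnm.le

theorem StableEquiv.sameClass (hT : T.IsTree) (hfin : ∀ v : V, (T.neighborSet v).Finite)
    {x y : V} (h : StableEquiv T φ x y) : SameClass T φ x y := by
  obtain ⟨g, hadj, hgx, -, hg⟩ := exists_aut_of_neighborSet_equiv hT
    (R := fun _ => StableEquiv T φ) h (h.exists_equiv hfin)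
    (by
      intro d u w p q hp hq hpq huw
      obtain ⟨σ, hσ⟩ := huw.exists_equiv hfin
      obtain ⟨τ, hτ, hτr⟩ := (stableEquiv_equivalence T φ).exists_equiv_apply_eq σ hσ
        ⟨p, hp⟩ ⟨q, hq⟩ hpq
      exact ⟨τ, hτ, fun a _ => hτr a⟩)
  exact ⟨g, hadj, hgx, fun v => (hg v 0 : φ v = φ (g v)).symm⟩

end ColorRefinement

section Special

variable {V A : Type*} {T : SimpleGraph V} {φ : V → A}

theorem ballEquiv_eq_refineEquiv (hT : T.IsTree) {k : ℕ}
    (hfin : ∀ v : V, (T.neighborSet v).Finite) (hreg : ∀ v : V, (T.neighborSet v).ncard = k) :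
    BallEquiv T φ = RefineEquiv T φ := by
  have hne : ∀ u w : V, Nonempty (T.neighborSet u ≃ T.neighborSet w) := by
    intro u w
    have := (hfin u).to_subtype
    have := (hfin w).to_subtype
    refine Finite.card_eq.mp ?_
    rw [Nat.card_coe_set_eq, Nat.card_coe_set_eq, hreg, hreg]
  funext n x y
  exact propext ⟨fun h => h.refineEquiv hT.connected hfin hreg, fun h => h.ballEquiv hT hne⟩

theorem refineEquiv_succ_of_not_isSpecial (hBE : BallEquiv T φ = RefineEquiv T φ) {n : ℕ}
    {x y : V} (hs : ¬ IsSpecial T φ n x) (h : RefineEquiv T φ n x y) :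
    RefineEquiv T φ (n + 1) x y := by
  by_contra hn
  refine hs ⟨x, y, ?_⟩
  rw [hBE]
  exact ⟨(refineEquiv_equivalence T φ n).refl x, h, hn⟩

theorem isSpecial_of_refineEquiv (hBE : BallEquiv T φ = RefineEquiv T φ) {n : ℕ} {x y : V}
    (h : RefineEquiv T φ n x y) (hs : IsSpecial T φ n x) : IsSpecial T φ n y := by
  obtain ⟨z, w, hz, hw, hzw⟩ := hs
  rw [hBE] at hz hw hzw
  have hr := refineEquiv_equivalence T φ n
  refine ⟨z, w, ?_⟩
  rw [hBE]
  exact ⟨hr.trans (hr.symm h) hz, hr.trans (hr.symm h) hw, hzw⟩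

theorem refineEquiv_of_not_isSpecial (hBE : BallEquiv T φ = RefineEquiv T φ) {m n : ℕ}
    (hmn : m ≤ n) {x y : V} (hs : ∀ i, m ≤ i → i < n → ¬ IsSpecial T φ i x)
    (h : RefineEquiv T φ m x y) : RefineEquiv T φ n x y := by
  induction n, hmn using Nat.le_induction with
  | base => exact h
  | succ n hn ih =>
    exact refineEquiv_succ_of_not_isSpecial hBE (hs n hn (by omega))
      (ih fun i hi hin => hs i hi (by omega))

theorem stableEquiv_of_not_isSpecial (hBE : BallEquiv T φ = RefineEquiv T φ) {m : ℕ}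
    {x y : V} (hs : ∀ i, m ≤ i → ¬ IsSpecial T φ i x) (h : RefineEquiv T φ m x y) :
    StableEquiv T φ x y := by
  intro n
  rcases le_total m n with hmn | hnm
  · exact refineEquiv_of_not_isSpecial hBE hmn (fun i hi _ => hs i hi) h
  · exact h.mono hnm

/-- Every vertex whose `(n + 1)`-ball is special has a neighbor whose `n`-ball is special. -/
theorem IsSpecial.exists_adj (hBE : BallEquiv T φ = RefineEquiv T φ) {n : ℕ} {x : V}
    (hs : IsSpecial T φ (n + 1) x) : ∃ a, T.Adj x a ∧ IsSpecial T φ n a := by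
  by_contra! hx
  obtain ⟨y, z, hy, hz, hyz⟩ := hs
  rw [hBE] at hy hz hyz
  have key : ∀ w, RefineEquiv T φ (n + 1) x w → RefineEquiv T φ (n + 2) x w := by
    rintro w ⟨h, σ, hσ⟩
    exact ⟨⟨h, σ, hσ⟩, σ, fun a => refineEquiv_succ_of_not_isSpecial hBE (hx a a.2) (hσ a)⟩
  have hr := refineEquiv_equivalence T φ (n + 2)
  exact hyz (hr.trans (hr.symm (key y hy)) (key z hz))

/-- For a surjection onto a set with one fewer element, any two pairs of distinct elements
that are identified coincide. -/
theorem eq_or_eq_of_surjective_of_card_eq_add_one {α β : Type*} [Finite α] {f : α → β}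
    (hf : Function.Surjective f) (hcard : Nat.card α = Nat.card β + 1) {a₁ a₂ b₁ b₂ : α}
    (ha : a₁ ≠ a₂) (hfa : f a₁ = f a₂) (hb : b₁ ≠ b₂) (hfb : f b₁ = f b₂) :
    b₁ = a₁ ∨ b₂ = a₁ := by
  have := Finite.of_surjective f hf
  let g : {a : α // a ≠ a₁} → β := fun a => f a
  have hg : Function.Surjective g := by
    intro b
    obtain ⟨a, rfl⟩ := hf b
    by_cases h : a = a₁
    · exact ⟨⟨a₂, ha.symm⟩, by rw [h]; exact hfa.symm⟩
    · exact ⟨⟨a, h⟩, rfl⟩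
  have hc : Nat.card {a : α // a ≠ a₁} = Nat.card β := by
    have h1 := Set.ncard_add_ncard_compl ({a₁} : Set α)
    rw [Set.ncard_singleton, ← Nat.card_coe_set_eq] at h1
    have h2 : Nat.card {a : α // a ≠ a₁} = Nat.card (({a₁} : Set α)ᶜ : Set α) := rfl
    omega
  have hinj := ((Nat.bijective_iff_surjective_and_card g).mpr ⟨hg, hc⟩).injective
  by_contra! h
  have := @hinj ⟨b₁, h.1⟩ ⟨b₂, h.2⟩ hfb
  exact hb (congrArg Subtype.val this)

theorem IsSturmian.card_quotient (hBE : BallEquiv T φ = RefineEquiv T φ)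
    (hst : IsSturmian T φ) (n : ℕ) : Nat.card (Quot (RefineEquiv T φ n)) = n + 2 := by
  rw [← hBE]
  exact hst n

theorem quot_mk_eq_iff {n : ℕ} {x y : V} :
    Quot.mk (RefineEquiv T φ n) x = Quot.mk _ y ↔ RefineEquiv T φ n x y :=
  (refineEquiv_equivalence T φ n).quot_mk_eq_iff x y

/-- Only one class of `n`-balls splits at each step, and it splits in two. -/
theorem IsSturmian.refineEquiv_or (hBE : BallEquiv T φ = RefineEquiv T φ)
    (hst : IsSturmian T φ) {n : ℕ} {x x' y y' : V} (hx : RefineEquiv T φ n x x')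
    (hx' : ¬ RefineEquiv T φ (n + 1) x x') (hy : RefineEquiv T φ n y y')
    (hy' : ¬ RefineEquiv T φ (n + 1) y y') :
    RefineEquiv T φ (n + 1) y x ∨ RefineEquiv T φ (n + 1) y' x := by
  have hn := hst.card_quotient hBE n
  have hn1 := hst.card_quotient hBE (n + 1)
  have : Finite (Quot (RefineEquiv T φ (n + 1))) := Nat.finite_of_card_ne_zero (by omega)
  let f : Quot (RefineEquiv T φ (n + 1)) → Quot (RefineEquiv T φ n) :=
    Quot.map id fun _ _ h => h.1
  have hf : Function.Surjective f := fun b => by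
    obtain ⟨v, rfl⟩ := Quot.exists_rep b
    exact ⟨Quot.mk _ v, rfl⟩
  have := eq_or_eq_of_surjective_of_card_eq_add_one hf (by omega)
    (mt quot_mk_eq_iff.mp hx') (quot_mk_eq_iff.mpr hx) (mt quot_mk_eq_iff.mp hy')
    (quot_mk_eq_iff.mpr hy)
  exact this.imp quot_mk_eq_iff.mp quot_mk_eq_iff.mp

theorem IsSturmian.refineEquiv_of_isSpecial (hBE : BallEquiv T φ = RefineEquiv T φ)
    (hst : IsSturmian T φ) {n : ℕ} {x y : V} (hx : IsSpecial T φ n x)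
    (hy : IsSpecial T φ n y) : RefineEquiv T φ n x y := by
  obtain ⟨a, b, ha, hb, hab⟩ := hx
  obtain ⟨c, d, hc, hd, hcd⟩ := hy
  rw [hBE] at ha hb hab hc hd hcd
  have hr := refineEquiv_equivalence T φ n
  rcases hst.refineEquiv_or hBE (hr.trans (hr.symm ha) hb) hab
    (hr.trans (hr.symm hc) hd) hcd with h | h
  · exact hr.trans ha (hr.trans (hr.symm h.1) (hr.symm hc))
  · exact hr.trans ha (hr.trans (hr.symm h.1) (hr.symm hd))

/-- A set of vertices meeting only finitely many stable classes. -/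
def StablyFinite (T : SimpleGraph V) (φ : V → A) (S : Set V) : Prop :=
  ∃ R : Set V, R.Finite ∧ ∀ v ∈ S, ∃ r ∈ R, StableEquiv T φ r v

/-- The vertices of a Sturmian coloring lie in infinitely many stable classes. -/
theorem IsSturmian.not_stablyFinite_univ (hBE : BallEquiv T φ = RefineEquiv T φ)
    (hst : IsSturmian T φ) : ¬ StablyFinite T φ Set.univ := by
  rintro ⟨R, hR, h⟩
  have := hR.to_subtype
  let f : R → Quot (RefineEquiv T φ (Nat.card R)) := fun r => Quot.mk _ (r : V)
  have hf : Function.Surjective f := by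
    intro b
    obtain ⟨v, rfl⟩ := Quot.exists_rep b
    obtain ⟨r, hr, hrv⟩ := h v trivial
    exact ⟨⟨r, hr⟩, quot_mk_eq_iff.mpr (hrv _)⟩
  have := Nat.card_le_card_of_surjective f hf
  rw [hst.card_quotient hBE] at this
  omega

theorem stablyFinite_isSpecial_succ (hBE : BallEquiv T φ = RefineEquiv T φ)
    (hfin : ∀ v : V, (T.neighborSet v).Finite) {n : ℕ}
    (h : StablyFinite T φ {v | IsSpecial T φ n v}) :
    StablyFinite T φ {v | IsSpecial T φ (n + 1) v} := by
  obtain ⟨R, hR, hRs⟩ := h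
  refine ⟨⋃ r ∈ R, T.neighborSet r, hR.biUnion fun r _ => hfin r, ?_⟩
  intro v hv
  obtain ⟨a, hva, ha⟩ := IsSpecial.exists_adj hBE hv
  obtain ⟨r, hr, hra⟩ := hRs a ha
  obtain ⟨σ, hσ⟩ := StableEquiv.exists_equiv hfin ((stableEquiv_equivalence T φ).symm hra)
  exact ⟨σ ⟨v, hva.symm⟩, Set.mem_biUnion hr (σ _).2,
    (stableEquiv_equivalence T φ).symm (hσ ⟨v, hva.symm⟩)⟩

/-- The special vertices of a Sturmian coloring never lie in finitely many stable classes. -/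
theorem IsSturmian.not_stablyFinite_isSpecial (hBE : BallEquiv T φ = RefineEquiv T φ)
    (hfin : ∀ v : V, (T.neighborSet v).Finite) (hst : IsSturmian T φ) (m : ℕ) :
    ¬ StablyFinite T φ {v | IsSpecial T φ m v} := by
  intro hm
  have hall : ∀ n, m ≤ n → StablyFinite T φ {v | IsSpecial T φ n v} := by
    intro n hn
    induction n, hn using Nat.le_induction with
    | base => exact hm
    | succ n _ ih => exact stablyFinite_isSpecial_succ hBE hfin ih
  have hclass : ∀ v, StablyFinite T φ {w | RefineEquiv T φ m v w} := by
    classical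
    intro v
    by_cases hv : ∃ n, m ≤ n ∧ IsSpecial T φ n v
    · obtain ⟨hmt, ht⟩ := Nat.find_spec hv
      obtain ⟨R, hR, hRs⟩ := hall _ hmt
      refine ⟨R, hR, fun w hw => hRs w ?_⟩
      refine isSpecial_of_refineEquiv hBE ?_ ht
      exact refineEquiv_of_not_isSpecial hBE hmt
        (fun i hi hit hs => Nat.find_min hv hit ⟨hi, hs⟩) hw
    · push Not at hv
      exact ⟨{v}, Set.finite_singleton v, fun w hw =>
        ⟨v, rfl, stableEquiv_of_not_isSpecial hBE hv hw⟩⟩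
  choose R hR hRs using hclass
  have := Nat.finite_of_card_ne_zero
    (show Nat.card (Quot (RefineEquiv T φ m)) ≠ 0 by rw [hst.card_quotient hBE]; omega)
  refine hst.not_stablyFinite_univ hBE
    ⟨⋃ c : Quot (RefineEquiv T φ m), R c.out, Set.finite_iUnion fun c => hR _, ?_⟩
  intro v _
  obtain ⟨r, hr, hrv⟩ := hRs (Quot.mk (RefineEquiv T φ m) v).out v
    (quot_mk_eq_iff.mp (Quot.out_eq _))
  exact ⟨r, Set.mem_iUnion.mpr ⟨_, hr⟩, hrv⟩

theorem maxType_spec {x : V} (hx : (TypeSet T φ x).Finite) :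
    (maxType T φ x = -1 ∧ ∀ n, ¬ IsSpecial T φ n x) ∨
      ∃ m : ℕ, maxType T φ x = m ∧ IsSpecial T φ m x ∧ ∀ n, m < n → ¬ IsSpecial T φ n x := by
  have hfin : (insert (-1) ((fun n : ℕ => (n : ℤ)) '' TypeSet T φ x)).Finite :=
    (hx.image _).insert _
  have hmem := (Set.insert_nonempty _ _).csSup_mem hfin
  have hle : ∀ n, IsSpecial T φ n x → (n : ℤ) ≤ maxType T φ x := fun n hn =>
    le_csSup hfin.bddAbove (Set.mem_insert_of_mem _ ⟨n, hn, rfl⟩)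
  rcases hmem with h | ⟨m, hm, h⟩
  · replace h : maxType T φ x = -1 := h
    refine Or.inl ⟨h, fun n hn => ?_⟩
    have := hle n hn
    omega
  · replace h : (m : ℤ) = maxType T φ x := h
    refine Or.inr ⟨m, h.symm, hm, fun n hmn hn => ?_⟩
    have := hle n hn
    omega

end Special

theorem stmt_11 {V A : Type*} (T : SimpleGraph V) (φ : V → A) (k : ℕ)
    (hk : 2 ≤ k) (htree : T.IsTree) (hreg : ∀ v : V, (T.neighborSet v).ncard = k)
    (hst : IsSturmian T φ) (hbd : ∀ v : V, (TypeSet T φ v).Finite)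
    (x y : V) (h : maxType T φ x = maxType T φ y) :
    SameClass T φ x y := by
  have hfin : ∀ v : V, (T.neighborSet v).Finite := fun v =>
    Set.finite_of_ncard_ne_zero (by rw [hreg]; omega)
  have hBE : BallEquiv T φ = RefineEquiv T φ := ballEquiv_eq_refineEquiv htree hfin hreg
  suffices StableEquiv T φ x y from this.sameClass htree hfin
  rcases maxType_spec (hbd x) with ⟨hx, hxs⟩ | ⟨m, hx, hxm, hxs⟩ <;>
    rcases maxType_spec (hbd y) with ⟨hy, hys⟩ | ⟨m', hy, hym, hys⟩
  · refine stableEquiv_of_not_isSpecial hBE (m := 0) (fun i _ => hxs i) ?_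
    by_contra hxy
    refine hst.not_stablyFinite_univ hBE ⟨{x, y}, by simp, fun v _ => ?_⟩
    by_cases hxv : RefineEquiv T φ 0 x v
    · exact ⟨x, by simp, stableEquiv_of_not_isSpecial hBE (fun i _ => hxs i) hxv⟩
    · refine ⟨y, by simp, stableEquiv_of_not_isSpecial hBE (m := 0) (fun i _ => hys i) ?_⟩
      have hcard := hst.card_quotient hBE 0
      have : Finite (Quot (RefineEquiv T φ 0)) := Nat.finite_of_card_ne_zero (by omega)
      rcases eq_or_eq_of_surjective_of_card_eq_add_one
        (f := fun _ : Quot (RefineEquiv T φ 0) => ()) (fun _ => ⟨Quot.mk _ x, rfl⟩)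
        (by simpa using hcard) (Ne.symm (mt quot_mk_eq_iff.mp hxy)) rfl
        (mt quot_mk_eq_iff.mp hxv) rfl with h | h
      · exact absurd (quot_mk_eq_iff.mp h) hxy
      · exact quot_mk_eq_iff.mp h.symm
  · omega
  · omega
  · obtain rfl : m = m' := by omega
    have hxy := hst.refineEquiv_of_isSpecial hBE hxm hym
    refine stableEquiv_of_not_isSpecial hBE (m := m + 1) (fun i hi => hxs i hi) ?_
    by_contra hxy'
    refine hst.not_stablyFinite_isSpecial hBE hfin m ⟨{x, y}, by simp, fun v hv => ?_⟩
    have hr := refineEquiv_equivalence T φ m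
    have hr' := refineEquiv_equivalence T φ (m + 1)
    by_cases hxv : RefineEquiv T φ (m + 1) x v
    · exact ⟨x, by simp, stableEquiv_of_not_isSpecial hBE (fun i hi => hxs i hi) hxv⟩
    · refine ⟨y, by simp, stableEquiv_of_not_isSpecial hBE (fun i hi => hys i hi) ?_⟩
      rcases hst.refineEquiv_or hBE (hr.symm hxy) (mt hr'.symm hxy')
        (hst.refineEquiv_of_isSpecial hBE hxm hv) hxv with h | h
      · exact absurd h hxy'
      · exact hr'.symm h
end

section
/- Suppose φ is Sturmian and of bounded type (every vertex has a finite type set), and let x be a vertex with maximal type τ(x) = m. Then: (1) every neighbor of x has maximal type m − 1, m or m + 1; (2) x has a neighbor of maximal type m + 1; (3) if some vertex of T has maximal type strictly smaller than m, then x has a neighbor of maximal type m − 1. -/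
open SimpleGraph

/-- A sequence of finer and finer equivalence relations on the vertices of a connected locally
finite graph, where each step breaks exactly one class into two, and where equivalence at level
`n + 1` matches neighbors at level `n`. -/
structure IsSplitting {V : Type*} (T : SimpleGraph V) (E : ℕ → V → V → Prop) : Prop where
  equiv : ∀ n, Equivalence (E n)
  mono : ∀ n x y, E (n + 1) x y → E n x y
  lift : ∀ n x y v, E (n + 1) x y → T.Adj x v → ∃ w, T.Adj y w ∧ E n v w
  finite : ∀ n, Finite (Quot (E n))
  base : ∃ t, ∀ y z, ¬ E 0 y z → E 0 y t ∨ E 0 z t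
  split : ∀ n, ∃ y z, E n y z ∧ ¬ E (n + 1) y z
  split_unique : ∀ n, ∃ t, ∀ y z, E n y z → ¬ E (n + 1) y z → E (n + 1) y t ∨ E (n + 1) z t
  connected : T.Connected
  locallyFinite : ∀ v, (T.neighborSet v).Finite

namespace IsSplitting

/-- The class of `x` splits at level `n`. -/
def Sp {V : Type*} (E : ℕ → V → V → Prop) (n : ℕ) (x : V) : Prop :=
  ∃ y z, E n x y ∧ E n x z ∧ ¬ E (n + 1) y z

/-- The elements whose class does not split from level `s` on. -/
def Stable {V : Type*} (E : ℕ → V → V → Prop) (s : ℕ) : Set V :=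
  {x | ∀ n, s ≤ n → ¬ Sp E n x}

variable {V : Type*} {T : SimpleGraph V} {E : ℕ → V → V → Prop}

theorem mono_le (h : IsSplitting T E) {m n : ℕ} (hmn : m ≤ n) {x y : V} (hxy : E n x y) :
    E m x y := by
  induction n, hmn using Nat.le_induction with
  | base => exact hxy
  | succ n _ ih => exact ih (h.mono n x y hxy)

theorem Sp.congr (h : IsSplitting T E) {n : ℕ} {x y : V} (hx : Sp E n x) (hxy : E n x y) :
    Sp E n y := by
  obtain ⟨a, b, ha, hb, hab⟩ := hx
  exact ⟨a, b, (h.equiv n).trans ((h.equiv n).symm hxy) ha,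
    (h.equiv n).trans ((h.equiv n).symm hxy) hb, hab⟩

theorem sp_left (h : IsSplitting T E) {n : ℕ} {x y : V} (hxy : E n x y)
    (hne : ¬ E (n + 1) x y) : Sp E n x :=
  ⟨x, y, (h.equiv n).refl x, hxy, hne⟩

theorem sp_right (h : IsSplitting T E) {n : ℕ} {x y : V} (hxy : E n x y)
    (hne : ¬ E (n + 1) x y) : Sp E n y :=
  Sp.congr h (sp_left h hxy hne) hxy

theorem exists_sp (h : IsSplitting T E) (n : ℕ) : ∃ x, Sp E n x := by
  obtain ⟨y, z, hyz, hne⟩ := h.split n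
  exact ⟨y, sp_left h hyz hne⟩

theorem Sp.rel (h : IsSplitting T E) {n : ℕ} {x y : V} (hx : Sp E n x) (hy : Sp E n y) :
    E n x y := by
  obtain ⟨t, ht⟩ := h.split_unique n
  have key : ∀ u, Sp E n u → E n u t := by
    rintro u ⟨a, b, ha, hb, hab⟩
    rcases ht a b ((h.equiv n).trans ((h.equiv n).symm ha) hb) hab with hh | hh
    · exact (h.equiv n).trans ha (h.mono _ _ _ hh)
    · exact (h.equiv n).trans hb (h.mono _ _ _ hh)
  exact (h.equiv n).trans (key x hx) ((h.equiv n).symm (key y hy))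

/-- The splitting class breaks into only two pieces. -/
theorem Sp.rel_succ (h : IsSplitting T E) {n : ℕ} {x y z : V} (hx : Sp E n x) (hy : Sp E n y)
    (hz : Sp E n z) (hxy : ¬ E (n + 1) x y) (hxz : ¬ E (n + 1) x z) : E (n + 1) y z := by
  obtain ⟨t, ht⟩ := h.split_unique n
  by_contra hyz
  have e := h.equiv (n + 1)
  rcases ht x y (hx.rel h hy) hxy with h1 | h1 <;>
  rcases ht x z (hx.rel h hz) hxz with h2 | h2 <;>
  rcases ht y z (hy.rel h hz) hyz with h3 | h3
  all_goals first
    | exact hxy (e.trans h1 (e.symm h3))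
    | exact hxz (e.trans h1 (e.symm h3))
    | exact hyz (e.trans h1 (e.symm h2))
    | exact hxy (e.trans h2 (e.symm h3))
    | exact hxz (e.trans h2 (e.symm h3))

theorem stable_mono {s t : ℕ} (hst : s ≤ t) : Stable E s ⊆ Stable E t :=
  fun _ hx n hn => hx n (hst.trans hn)

theorem Sp.notMem {n s : ℕ} (hs : s ≤ n) {x : V} (hx : Sp E n x) : x ∉ Stable E s :=
  fun hx' => hx' n hs hx

theorem sp_of_notMem {s : ℕ} {x : V} (h1 : x ∈ Stable E (s + 1)) (h0 : x ∉ Stable E s) :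
    Sp E s x := by
  simp only [Stable, Set.mem_ofPred_eq, not_forall, not_not] at h0 h1
  obtain ⟨n, hn, hsp⟩ := h0
  rcases hn.eq_or_lt with rfl | hlt
  · exact hsp
  · exact absurd hsp (h1 n hlt)

theorem rel_of_stable (h : IsSplitting T E) {s : ℕ} {x y : V} (hx : x ∈ Stable E s)
    (hxy : E s x y) (n : ℕ) : E n x y := by
  rcases le_total n s with hn | hn
  · exact h.mono_le hn hxy
  · induction n, hn using Nat.le_induction with
    | base => exact hxy
    | succ n hn ih =>
      by_contra hne
      exact hx n hn (sp_left h ih hne)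

theorem stable_congr (h : IsSplitting T E) {s : ℕ} {x y : V} (hx : x ∈ Stable E s)
    (hxy : E s x y) : y ∈ Stable E s := fun n hn hy =>
  hx n hn (hy.congr h ((h.equiv n).symm (h.rel_of_stable hx hxy n)))

/-- The set `S` together with all its neighbors. -/
def thicken (T : SimpleGraph V) (S : Set V) : Set V := S ∪ {v | ∃ u ∈ S, T.Adj u v}

/-- `S` is a union of classes of level `n`. -/
def Saturated (E : ℕ → V → V → Prop) (n : ℕ) (S : Set V) : Prop :=
  ∀ x y, E n x y → x ∈ S → y ∈ S

theorem Saturated.mono (h : IsSplitting T E) {m n : ℕ} (hmn : m ≤ n) {S : Set V}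
    (hS : Saturated E m S) : Saturated E n S :=
  fun x y hxy hx => hS x y (h.mono_le hmn hxy) hx

theorem Saturated.thicken (h : IsSplitting T E) {n : ℕ} {S : Set V} (hS : Saturated E n S) :
    Saturated E (n + 1) (thicken T S) := by
  rintro x y hxy (hx | ⟨u, hu, hux⟩)
  · exact Or.inl (hS x y (h.mono _ _ _ hxy) hx)
  · obtain ⟨w, hw, huw⟩ := h.lift n x y u hxy hux.symm
    exact Or.inr ⟨w, hS u w huw hu, hw.symm⟩

theorem saturated_stable (h : IsSplitting T E) (s : ℕ) : Saturated E s (Stable E s) :=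
  fun _ _ hxy hx => h.stable_congr hx hxy

theorem sp_of_not_saturated (h : IsSplitting T E) {n : ℕ} {S : Set V}
    (h0 : ¬ Saturated E n S) (h1 : Saturated E (n + 1) S) :
    ∃ x y, x ∈ S ∧ y ∉ S ∧ Sp E n x ∧ Sp E n y := by
  simp only [Saturated, not_forall] at h0
  obtain ⟨x, y, hxy, hx, hy⟩ := h0
  have hne : ¬ E (n + 1) x y := fun hE => hy (h1 x y hE hx)
  exact ⟨x, y, hx, hy, sp_left h hxy hne, sp_right h hxy hne⟩

theorem subset_thicken (S : Set V) : S ⊆ thicken T S := Set.subset_union_left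

theorem thicken_mono {S S' : Set V} (hS : S ⊆ S') : thicken T S ⊆ thicken T S' := by
  rintro x (hx | ⟨u, hu, hux⟩)
  · exact Or.inl (hS hx)
  · exact Or.inr ⟨u, hS hu, hux⟩

theorem exists_thicken_stable (h : IsSplitting T E) (hbd : ∀ x, ∃ s, x ∈ Stable E s) (M : ℕ) :
    ∃ M', thicken T (Stable E M) ⊆ Stable E M' := by
  choose r hr using hbd
  have hR : ∀ x, ∃ R, ∀ y, T.Adj x y → r y ≤ R := by
    intro x
    obtain ⟨R, hR⟩ := ((h.locallyFinite x).image r).bddAbove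
    exact ⟨R, fun y hy => hR ⟨y, hy, rfl⟩⟩
  choose R hR using hR
  have := h.finite M
  obtain ⟨K, hK⟩ := (Set.finite_range fun c : Quot (E M) => R c.out).bddAbove
  refine ⟨max M K, ?_⟩
  rintro v (hv | ⟨x, hx, hxv⟩)
  · exact stable_mono (le_max_left _ _) hv
  · have hxc : E M x (Quot.mk (E M) x).out :=
      (h.equiv M).symm ((h.equiv M).quot_mk_eq_iff _ _ |>.1 (Quot.out_eq (Quot.mk (E M) x)))
    obtain ⟨y, hy, hvy⟩ := h.lift (max M K) _ _ v (h.rel_of_stable hx hxc _) hxv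
    have hyK : r y ≤ max M K :=
      ((hR _ y hy).trans (hK ⟨_, rfl⟩)).trans (le_max_right _ _)
    exact h.stable_congr (stable_mono hyK (hr y)) ((h.equiv _).symm hvy)

theorem iterate_thicken_subset (h : IsSplitting T E) (hbd : ∀ x, ∃ s, x ∈ Stable E s) (s i : ℕ) :
    ∃ M, (thicken T)^[i] (Stable E s) ⊆ Stable E M := by
  induction i with
  | zero => exact ⟨s, subset_rfl⟩
  | succ i ih =>
    obtain ⟨M, hM⟩ := ih
    obtain ⟨M', hM'⟩ := h.exists_thicken_stable hbd M
    refine ⟨M', ?_⟩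
    rw [Function.iterate_succ_apply']
    exact (thicken_mono hM).trans hM'

theorem eq_univ_of_thicken_subset (h : IsSplitting T E) {S : Set V} (hne : S.Nonempty)
    (hS : thicken T S ⊆ S) : S = Set.univ := by
  obtain ⟨a, ha⟩ := hne
  refine Set.eq_univ_of_forall fun b => ?_
  obtain ⟨p⟩ := h.connected.preconnected a b
  induction p with
  | nil => exact ha
  | cons hadj _ ih => exact ih (hS (Or.inr ⟨_, ha, hadj⟩))

theorem exists_mem_iterate_succ (h : IsSplitting T E) (hbd : ∀ x, ∃ s, x ∈ Stable E s) {s : ℕ}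
    (hs : (Stable E s).Nonempty) (i : ℕ) :
    ∃ x ∈ (thicken T)^[i + 1] (Stable E s), x ∉ (thicken T)^[i] (Stable E s) := by
  by_contra! hcon
  have hsub : ∀ j, Stable E s ⊆ (thicken T)^[j] (Stable E s) := by
    intro j
    induction j with
    | zero => exact subset_rfl
    | succ j ih =>
      rw [Function.iterate_succ_apply']
      exact ih.trans (subset_thicken _)
  have huniv := h.eq_univ_of_thicken_subset (hs.mono (hsub i)) (fun x hx => hcon x (by
    rwa [Function.iterate_succ_apply']))
  obtain ⟨M, hM⟩ := h.iterate_thicken_subset hbd s i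
  obtain ⟨x, hx⟩ := h.exists_sp M
  exact hx.notMem le_rfl (hM (huniv ▸ Set.mem_univ x))

theorem exists_not_saturated (h : IsSplitting T E) (hbd : ∀ x, ∃ s, x ∈ Stable E s) {s : ℕ}
    (hs : (Stable E s).Nonempty) (n : ℕ) :
    ∃ i, ¬ Saturated E n ((thicken T)^[i] (Stable E s)) := by
  by_contra! hcon
  choose f hf hf' using h.exists_mem_iterate_succ hbd hs
  have hmono : Monotone fun i => (thicken T)^[i] (Stable E s) :=
    monotone_nat_of_le_succ fun i => by
      simp only [Function.iterate_succ_apply']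
      exact subset_thicken _
  have := h.finite n
  obtain ⟨i, j, hij, he⟩ := Finite.exists_ne_map_eq_of_infinite fun i => Quot.mk (E n) (f i)
  have he' : E n (f i) (f j) := ((h.equiv n).quot_mk_eq_iff _ _).1 he
  rcases lt_or_gt_of_ne hij with hlt | hlt
  · exact hf' j (hcon j _ _ he' (hmono (Nat.succ_le_of_lt hlt) (hf i)))
  · exact hf' i (hcon i _ _ ((h.equiv n).symm he') (hmono (Nat.succ_le_of_lt hlt) (hf j)))

/-- If some class is stable at level `s`, then the class splitting at level `s` contains both
elements adjacent to the stable part and elements not adjacent to it. -/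
theorem exists_sp_adj_and_not_adj (h : IsSplitting T E) (hbd : ∀ x, ∃ s, x ∈ Stable E s) {s : ℕ}
    (hs : (Stable E s).Nonempty) :
    (∃ v, Sp E s v ∧ ∃ u ∈ Stable E s, T.Adj u v) ∧
      ∃ w, Sp E s w ∧ ∀ u ∈ Stable E s, ¬ T.Adj u w := by
  have hsat := h.saturated_stable s
  by_cases h1 : Saturated E s (thicken T (Stable E s))
  · exfalso
    obtain ⟨x, hx, hx'⟩ := h.exists_mem_iterate_succ hbd hs 0
    simp only [Stable, Function.iterate_zero, id, Set.mem_ofPred_eq, not_forall, not_not] at hx'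
    obtain ⟨n, hn, hsp⟩ := hx'
    classical
    have hex := h.exists_not_saturated hbd hs n
    have hmin := fun m => Nat.find_min (m := m) hex
    have hspec := Nat.find_spec hex
    obtain ⟨i, hi⟩ : ∃ i, Nat.find hex = i + 2 := by
      have h0 : Nat.find hex ≠ 0 := fun h0 => hspec (by
        rw [h0]; exact hsat.mono h hn)
      have h1' : Nat.find hex ≠ 1 := fun h0 => hspec (by
        rw [h0]; exact h1.mono h hn)
      exact ⟨Nat.find hex - 2, by omega⟩
    rw [hi] at hspec hmin
    have hsi : Saturated E n ((thicken T)^[i + 1] (Stable E s)) :=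
      not_not.1 (hmin (i + 1) (by omega))
    obtain ⟨a, b, ha, hb, hspa, hspb⟩ := h.sp_of_not_saturated hspec (by
      rw [Function.iterate_succ_apply']
      exact hsi.thicken h)
    have hmono : Monotone fun i => (thicken T)^[i] (Stable E s) :=
      monotone_nat_of_le_succ fun i => by
        simp only [Function.iterate_succ_apply']
        exact subset_thicken _
    exact hb (hmono (Nat.le_succ (i + 1))
      (hsi x b (hsp.rel h hspb) (hmono (by omega : 0 + 1 ≤ i + 1) hx)))
  · obtain ⟨x, y, hx, hy, hspx, hspy⟩ := h.sp_of_not_saturated h1 (hsat.thicken h)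
    refine ⟨⟨x, hspx, ?_⟩, y, hspy, fun u hu hadj => hy (Or.inr ⟨u, hu, hadj⟩)⟩
    exact hx.resolve_left (hspx.notMem le_rfl)

theorem adj_stable_congr (h : IsSplitting T E) {s n : ℕ} (hsn : s ≤ n) {x y u : V}
    (hxy : E (n + 1) x y) (hu : u ∈ Stable E s) (hadj : T.Adj u x) :
    ∃ w ∈ Stable E s, T.Adj w y := by
  obtain ⟨w, hw, huw⟩ := h.lift n x y u hxy hadj.symm
  exact ⟨w, h.stable_congr hu (h.mono_le hsn huw), hw.symm⟩

theorem not_adj_of_sp (h : IsSplitting T E) (hbd : ∀ x, ∃ s, x ∈ Stable E s) {s n : ℕ}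
    (hsn : s < n) {u v : V} (hu : u ∈ Stable E s) (hv : Sp E n v) : ¬ T.Adj u v := by
  intro hadj
  obtain ⟨n, rfl⟩ : ∃ j, n = j + 1 := ⟨n - 1, by omega⟩
  obtain ⟨-, w, hw, hw'⟩ := h.exists_sp_adj_and_not_adj hbd ⟨u, stable_mono hsn.le hu⟩
  obtain ⟨u', hu', hadj'⟩ :=
    h.adj_stable_congr (Nat.le_of_lt_succ hsn) (hv.rel h hw) hu hadj
  exact hw' u' (stable_mono hsn.le hu') hadj'

theorem mem_stable_succ_of_adj (h : IsSplitting T E) (hbd : ∀ x, ∃ s, x ∈ Stable E s) {s : ℕ}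
    {u v : V} (hu : u ∈ Stable E s) (hadj : T.Adj u v) : v ∈ Stable E (s + 1) :=
  fun _ hn hsp => h.not_adj_of_sp hbd hn hu hsp hadj

theorem exists_sp_notMem_stable_succ (h : IsSplitting T E) (hbd : ∀ x, ∃ s, x ∈ Stable E s)
    {s : ℕ} (hs : (Stable E (s + 1)).Nonempty) : ∃ x, Sp E s x ∧ x ∉ Stable E (s + 1) := by
  obtain ⟨⟨v, hv, u, hu, huv⟩, w, hw, hw'⟩ := h.exists_sp_adj_and_not_adj hbd hs
  obtain ⟨u', hu', he⟩ := h.lift s v w u (hv.rel h hw) huv.symm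
  have hn : u' ∉ Stable E (s + 1) := fun hm => hw' u' hm hu'.symm
  have hus : u ∉ Stable E s := fun hm => hn (stable_mono (Nat.le_succ s) (h.stable_congr hm he))
  exact ⟨u', (sp_of_notMem hu hus).congr h he, hn⟩

theorem rel_of_mem_stable (h : IsSplitting T E) (hbd : ∀ x, ∃ s, x ∈ Stable E s) {s : ℕ}
    {x y : V} (hx : x ∈ Stable E (s + 1)) (hy : y ∈ Stable E (s + 1)) (hx' : x ∉ Stable E s)
    (hy' : y ∉ Stable E s) : E (s + 1) x y := by
  obtain ⟨w, hw, hw'⟩ := h.exists_sp_notMem_stable_succ hbd ⟨x, hx⟩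
  exact hw.rel_succ h (sp_of_notMem hx hx') (sp_of_notMem hy hy')
    (fun he => hw' (h.stable_congr hx ((h.equiv _).symm he)))
    (fun he => hw' (h.stable_congr hy ((h.equiv _).symm he)))

theorem rel_of_mem_stable_zero (h : IsSplitting T E) {x y : V} (hx : x ∈ Stable E 0)
    (hy : y ∈ Stable E 0) : E 0 x y := by
  obtain ⟨w, hw⟩ := h.exists_sp 0
  have e := h.equiv 0
  have hwx : ¬ E 0 w x := fun he => (hw.congr h he).notMem le_rfl hx
  have hwy : ¬ E 0 w y := fun he => (hw.congr h he).notMem le_rfl hy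
  obtain ⟨t, ht⟩ := h.base
  by_contra hxy
  rcases ht w x hwx with h1 | h1 <;> rcases ht w y hwy with h2 | h2 <;>
    rcases ht x y hxy with h3 | h3
  all_goals first
    | exact hwx (e.trans h1 (e.symm h3))
    | exact hwy (e.trans h1 (e.symm h3))
    | exact hxy (e.trans h1 (e.symm h2))
    | exact hwx (e.trans h2 (e.symm h3))
    | exact hwy (e.trans h2 (e.symm h3))

theorem exists_adj_stable (h : IsSplitting T E) (hbd : ∀ x, ∃ s, x ∈ Stable E s) {s : ℕ}
    (hs : (Stable E s).Nonempty) {x : V} (hx : x ∈ Stable E (s + 1)) (hx' : x ∉ Stable E s) :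
    ∃ u ∈ Stable E s, T.Adj u x := by
  obtain ⟨⟨v, hv, u, hu, huv⟩, -⟩ := h.exists_sp_adj_and_not_adj hbd hs
  have hv' : v ∈ Stable E (s + 1) := h.mem_stable_succ_of_adj hbd hu huv
  exact h.adj_stable_congr le_rfl
    (h.rel_of_mem_stable hbd hv' hx (hv.notMem le_rfl) hx') hu huv

/-- The first level from which on the class of `x` is stable. -/
noncomputable def rank (E : ℕ → V → V → Prop) (x : V) : ℕ := sInf {s | x ∈ Stable E s}

theorem rank_le_iff (hbd : ∀ x, ∃ s, x ∈ Stable E s) {x : V} {s : ℕ} :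
    rank E x ≤ s ↔ x ∈ Stable E s :=
  ⟨fun hle => stable_mono hle (Nat.sInf_mem (hbd x)), fun hx => Nat.sInf_le hx⟩

theorem rank_le_succ_of_adj (h : IsSplitting T E) (hbd : ∀ x, ∃ s, x ∈ Stable E s) {x y : V}
    (hxy : T.Adj x y) : rank E y ≤ rank E x + 1 :=
  (rank_le_iff hbd).2 (h.mem_stable_succ_of_adj hbd ((rank_le_iff hbd).1 le_rfl) hxy)

theorem exists_adj_rank_pred (h : IsSplitting T E) (hbd : ∀ x, ∃ s, x ∈ Stable E s) {x z : V}
    (hz : rank E z < rank E x) : ∃ y, T.Adj x y ∧ rank E y + 1 = rank E x := by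
  obtain ⟨s, hs⟩ : ∃ s, rank E x = s + 1 := ⟨rank E x - 1, by omega⟩
  obtain ⟨u, hu, hux⟩ := h.exists_adj_stable hbd (s := s) (x := x)
    ⟨z, (rank_le_iff hbd).1 (by omega)⟩ ((rank_le_iff hbd).1 hs.le)
    (fun hx => by have := (rank_le_iff hbd).2 hx; omega)
  have h1 := (rank_le_iff hbd).2 hu
  have h2 := h.rank_le_succ_of_adj hbd hux
  exact ⟨u, hux.symm, by omega⟩

theorem rel_of_rank_eq (h : IsSplitting T E) (hbd : ∀ x, ∃ s, x ∈ Stable E s) {x y : V}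
    (hxy : rank E x = rank E y) (n : ℕ) : E n x y := by
  have hx : x ∈ Stable E (rank E x) := (rank_le_iff hbd).1 le_rfl
  have hy : y ∈ Stable E (rank E x) := (rank_le_iff hbd).1 hxy.ge
  refine h.rel_of_stable hx ?_ n
  rcases hr : rank E x with _ | s
  · rw [hr] at hx hy
    exact h.rel_of_mem_stable_zero hx hy
  · rw [hr] at hx hy
    refine h.rel_of_mem_stable hbd hx hy ?_ ?_ <;>
    · rw [← rank_le_iff hbd]
      omega

theorem exists_adj_rank_succ (h : IsSplitting T E) (hbd : ∀ x, ∃ s, x ∈ Stable E s) (x : V) :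
    ∃ y, T.Adj x y ∧ rank E y = rank E x + 1 := by
  obtain ⟨⟨v, hv, u, hu, huv⟩, -⟩ := h.exists_sp_adj_and_not_adj hbd
    ⟨x, (rank_le_iff hbd).1 (le_refl (rank E x))⟩
  have h1 := (rank_le_iff hbd).2 hu
  have h2 := h.rank_le_succ_of_adj hbd huv
  have h3 : ¬ rank E v ≤ rank E x := fun hle => hv.notMem le_rfl ((rank_le_iff hbd).1 hle)
  obtain ⟨w, hw, hvw⟩ := h.lift (rank E v) u x v
    (h.rel_of_rank_eq hbd (by omega) _) huv
  have hw1 : rank E w ≤ rank E v :=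
    (rank_le_iff hbd).2 (h.stable_congr ((rank_le_iff hbd).1 le_rfl) hvw)
  have hw2 : ¬ rank E w ≤ rank E x := fun hle =>
    (hv.congr h (h.mono_le (by omega) hvw)).notMem le_rfl ((rank_le_iff hbd).1 hle)
  exact ⟨w, hw, by omega⟩

end IsSplitting

theorem exists_forall_eq_or_eq_of_surjective {α β : Type*} [Finite α] {π : α → β}
    (hπ : Function.Surjective π) (hcard : Nat.card α = Nat.card β + 1) :
    ∃ t, ∀ a b, π a = π b → a ≠ b → a = t ∨ b = t := by
  have hσ := Function.injective_surjInv hπ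
  set σ := Function.surjInv hπ with hσ_def
  have h1 : (Set.range σ).ncard = Nat.card β := by
    rw [← Nat.card_coe_set_eq, Nat.card_range_of_injective hσ]
  have h2 := Set.ncard_add_ncard_compl (Set.range σ)
  obtain ⟨t, ht⟩ := Set.ncard_eq_one.1 (show ((Set.range σ)ᶜ).ncard = 1 by omega)
  have key : ∀ a, a = σ (π a) ∨ a = t := by
    intro a
    by_cases ha : a ∈ Set.range σ
    · obtain ⟨b, rfl⟩ := ha
      exact Or.inl (by rw [hσ_def, Function.surjInv_eq hπ])
    · exact Or.inr (by simpa [ht] using (show a ∈ (Set.range σ)ᶜ from ha))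
  refine ⟨t, fun a b hab hne => ?_⟩
  rcases key a with ha | ha
  · rcases key b with hb | hb
    · exact absurd (ha.trans ((congrArg σ hab).trans hb.symm)) hne
    · exact Or.inr hb
  · exact Or.inl ha

section Ball

variable {V A : Type*} {T : SimpleGraph V} {φ : V → A}

theorem ballEquiv_equivalence (T : SimpleGraph V) (φ : V → A) (n : ℕ) :
    Equivalence (BallEquiv T φ n) where
  refl x := ⟨Equiv.refl _, rfl, fun _ _ => Iff.rfl, fun _ => rfl⟩
  symm := by
    rintro x y ⟨f, hf, hadj, hcol⟩
    refine ⟨f.symm, ?_, fun u w => ?_, fun v => ?_⟩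
    · have : f.symm ⟨y, by simp⟩ = ⟨x, by simp⟩ := by
        rw [Equiv.symm_apply_eq]
        exact Subtype.ext hf.symm
      rw [this]
    · rw [hadj, f.apply_symm_apply, f.apply_symm_apply]
    · rw [← hcol, f.apply_symm_apply]
  trans := by
    rintro x y z ⟨f, hf, hadj, hcol⟩ ⟨g, hg, hadj', hcol'⟩
    refine ⟨f.trans g, ?_, fun u w => ?_, fun v => ?_⟩
    · have : f ⟨x, by simp⟩ = ⟨y, by simp⟩ := Subtype.ext hf
      rw [Equiv.trans_apply, this, hg]
    · rw [hadj, hadj']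
      rfl
    · rw [Equiv.trans_apply, hcol', hcol]

theorem SimpleGraph.Connected.exists_adj_dist_eq (hT : T.Connected) {v u : V} {d : ℕ}
    (h : T.dist v u = d + 1) : ∃ w, T.Adj w u ∧ T.dist v w = d := by
  obtain ⟨p, hp⟩ := hT.exists_walk_length_eq_dist u v
  rw [T.dist_comm] at h
  cases p with
  | nil => simp at h
  | @cons _ w _ hadj q =>
    refine ⟨w, hadj.symm, ?_⟩
    have h1 := T.dist_le q
    have h2 := hT.dist_triangle (u := u) (v := w) (w := v)
    rw [SimpleGraph.dist_eq_one_iff_adj.2 hadj] at h2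
    rw [SimpleGraph.Walk.length_cons] at hp
    rw [T.dist_comm]
    omega

/-- A map of balls preserving adjacency does not increase distances, as long as geodesics stay
in the ball. -/
theorem dist_map_le_of_ball (hT : T.Connected) {N n : ℕ} {x y : V}
    (f : {v : V // T.dist x v ≤ N} → {v : V // T.dist y v ≤ N})
    (hadj : ∀ u w : {v : V // T.dist x v ≤ N}, T.Adj (u : V) (w : V) →
      T.Adj (f u : V) (f w : V))
    (v u : {v : V // T.dist x v ≤ N}) (hv : T.dist x v + n ≤ N) (hu : T.dist v.1 u ≤ n) :
    T.dist (f v : V) (f u) ≤ T.dist v.1 u := by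
  generalize hd : T.dist v.1 u = d
  rw [hd] at hu
  induction d generalizing u with
  | zero =>
    have : v = u := Subtype.ext ((hT.dist_eq_zero_iff).1 hd)
    simp [this]
  | succ d ih =>
    obtain ⟨w, hw, hvw⟩ := hT.exists_adj_dist_eq hd
    have hxw := hT.dist_triangle (u := x) (v := v) (w := w)
    have h1 := ih ⟨w, by omega⟩ (by omega) hvw
    have h2 := hT.dist_triangle (u := (f v : V)) (v := f ⟨w, by omega⟩) (w := f u)
    rw [SimpleGraph.dist_eq_one_iff_adj.2 (hadj ⟨w, by omega⟩ u hw)] at h2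
    omega

/-- An equivalence of balls restricts to an equivalence of smaller balls inside them. -/
theorem ballEquiv_restrict (hT : T.Connected) {N n : ℕ} {x y : V}
    (f : {v : V // T.dist x v ≤ N} ≃ {v : V // T.dist y v ≤ N})
    (hf : (f ⟨x, by simp⟩ : V) = y)
    (hadj : ∀ u w : {v : V // T.dist x v ≤ N}, T.Adj (u : V) (w : V) ↔ T.Adj (f u : V) (f w : V))
    (hcol : ∀ v : {v : V // T.dist x v ≤ N}, φ (f v : V) = φ (v : V))
    (v : {v : V // T.dist x v ≤ N}) (hv : T.dist x v + n ≤ N) : BallEquiv T φ n v (f v) := by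
  have hadj' : ∀ u w : {v : V // T.dist y v ≤ N}, T.Adj (u : V) (w : V) →
      T.Adj (f.symm u : V) (f.symm w : V) := fun u w h => by
    rw [hadj, f.apply_symm_apply, f.apply_symm_apply]
    exact h
  have hfv : T.dist y (f v) + n ≤ N := by
    have := dist_map_le_of_ball hT (n := N) f (fun u w => (hadj u w).1) ⟨x, by simp⟩ v
      (by simp) v.2
    rw [hf] at this
    exact (Nat.add_le_add_right this n).trans hv
  have hin : ∀ {c a u : V}, T.dist c a + n ≤ N → T.dist a u ≤ n → T.dist c u ≤ N :=
    fun {c a u} h1 h2 => (hT.dist_triangle (v := a)).trans (by omega)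
  have hto : ∀ u (hu : T.dist v.1 u ≤ n), T.dist (f v : V) (f ⟨u, hin hv hu⟩) ≤ n := fun u hu =>
    (dist_map_le_of_ball hT f (fun u w => (hadj u w).1) v ⟨u, hin hv hu⟩ hv hu).trans hu
  have hinv : ∀ u (hu : T.dist (f v : V) u ≤ n),
      T.dist v.1 (f.symm ⟨u, hin hfv hu⟩) ≤ n := fun u hu => by
    have := dist_map_le_of_ball hT f.symm hadj' (f v) ⟨u, hin hfv hu⟩ hfv hu
    rw [f.symm_apply_apply] at this
    exact this.trans hu
  refine ⟨⟨fun u => ⟨f ⟨u, hin hv u.2⟩, hto u u.2⟩,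
    fun u => ⟨f.symm ⟨u, hin hfv u.2⟩, hinv u u.2⟩, fun u => ?_, fun u => ?_⟩, ?_, ?_, ?_⟩
  · exact Subtype.ext (by simp)
  · exact Subtype.ext (by simp)
  · rfl
  · exact fun u w => hadj ⟨u, hin hv u.2⟩ ⟨w, hin hv w.2⟩
  · exact fun u => hcol ⟨u, hin hv u.2⟩

theorem BallEquiv.of_succ (hT : T.Connected) {n : ℕ} {x y : V} (h : BallEquiv T φ (n + 1) x y) :
    BallEquiv T φ n x y := by
  obtain ⟨f, hf, hadj, hcol⟩ := h
  have := ballEquiv_restrict hT (n := n) f hf hadj hcol ⟨x, by simp⟩ (by simp)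
  rwa [hf] at this

theorem BallEquiv.exists_adj (hT : T.Connected) {n : ℕ} {x y v : V}
    (h : BallEquiv T φ (n + 1) x y) (hv : T.Adj x v) : ∃ w, T.Adj y w ∧ BallEquiv T φ n v w := by
  obtain ⟨f, hf, hadj, hcol⟩ := h
  have hd : T.dist x v = 1 := SimpleGraph.dist_eq_one_iff_adj.2 hv
  have hxv := (hadj ⟨x, by simp⟩ ⟨v, by omega⟩).1 hv
  rw [hf] at hxv
  exact ⟨_, hxv, ballEquiv_restrict hT f hf hadj hcol ⟨v, by omega⟩ (by simp only; omega)⟩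

theorem IsSturmian.isSplitting (hst : IsSturmian T φ) (hT : T.Connected)
    (hfin : ∀ v, (T.neighborSet v).Finite) : IsSplitting T (BallEquiv T φ) := by
  have hQ : ∀ n, Finite (Quot (BallEquiv T φ n)) := fun n =>
    Nat.finite_of_card_ne_zero (by
      have := hst n
      unfold ballComplexity at this
      omega)
  have hiff : ∀ n x y, Quot.mk (BallEquiv T φ n) x = Quot.mk _ y ↔ BallEquiv T φ n x y :=
    fun n => (ballEquiv_equivalence T φ n).quot_mk_eq_iff
  let π : ∀ n, Quot (BallEquiv T φ (n + 1)) → Quot (BallEquiv T φ n) := fun n =>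
    Quot.map id fun _ _ h => h.of_succ hT
  have hcard : ∀ n, Nat.card (Quot (BallEquiv T φ (n + 1))) =
      Nat.card (Quot (BallEquiv T φ n)) + 1 := fun n => by
    have h1 := hst n
    have h2 := hst (n + 1)
    unfold ballComplexity at h1 h2
    omega
  refine ⟨ballEquiv_equivalence T φ, fun _ _ _ h => h.of_succ hT,
    fun _ _ _ _ h hv => h.exists_adj hT hv, hQ, ?_, fun n => ?_, fun n => ?_, hT, hfin⟩
  · obtain ⟨a, b, -, hab⟩ := Nat.card_eq_two_iff.1 (hst 0)
    refine ⟨a.out, fun y z hyz => ?_⟩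
    simp only [← hiff, Quot.out_eq] at hyz ⊢
    have hy : Quot.mk (BallEquiv T φ 0) y ∈ ({a, b} : Set _) := hab ▸ Set.mem_univ _
    have hz : Quot.mk (BallEquiv T φ 0) z ∈ ({a, b} : Set _) := hab ▸ Set.mem_univ _
    rcases hy with hy | hy
    · exact Or.inl hy
    · rcases hz with hz | hz
      · exact Or.inr hz
      · exact absurd (hy.trans (Eq.symm hz)) hyz
  · by_contra! hcon
    have hinj : Function.Injective (π n) := by
      rintro ⟨y⟩ ⟨z⟩ hyz
      exact (hiff _ _ _).2 (hcon y z ((hiff _ _ _).1 hyz))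
    have := Nat.card_le_card_of_injective _ hinj
    have := hcard n
    omega
  · have hsurj : Function.Surjective (π n) := by
      rintro ⟨y⟩
      exact ⟨Quot.mk _ y, rfl⟩
    obtain ⟨t, ht⟩ := exists_forall_eq_or_eq_of_surjective hsurj (hcard n)
    refine ⟨t.out, fun y z hyz hne => ?_⟩
    simp only [← hiff, Quot.out_eq] at hne ⊢
    exact ht _ _ ((hiff _ _ _).2 hyz) hne

theorem exists_mem_stable (hbd : ∀ v : V, (TypeSet T φ v).Finite) (x : V) :
    ∃ s, x ∈ IsSplitting.Stable (BallEquiv T φ) s := by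
  obtain ⟨s, hs⟩ := (hbd x).bddAbove
  exact ⟨s + 1, fun n hn hsp => by
    have : n ≤ s := hs hsp
    omega⟩

theorem maxType_eq_rank (hbd : ∀ v : V, (TypeSet T φ v).Finite) (x : V) :
    maxType T φ x = (IsSplitting.rank (BallEquiv T φ) x : ℤ) - 1 := by
  have hiff := fun s => IsSplitting.rank_le_iff (exists_mem_stable hbd) (x := x) (s := s)
  refine IsGreatest.csSup_eq ⟨?_, ?_⟩
  · rcases hr : IsSplitting.rank (BallEquiv T φ) x with _ | s
    · simp
    · refine Or.inr ⟨s, IsSplitting.sp_of_notMem ((hiff _).1 hr.le) fun hx => ?_, by simp⟩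
      have := (hiff _).2 hx
      omega
  · rintro _ (rfl | ⟨n, hn, rfl⟩)
    · omega
    · by_contra hlt
      exact (hiff n).1 (by simp only at hlt; omega) n le_rfl hn

end Ball

theorem stmt_12 {V A : Type*} (T : SimpleGraph V) (φ : V → A) (k : ℕ)
    (hk : 2 ≤ k) (htree : T.IsTree) (hreg : ∀ v : V, (T.neighborSet v).ncard = k)
    (hst : IsSturmian T φ) (hbd : ∀ v : V, (TypeSet T φ v).Finite)
    (x : V) (m : ℤ) (hx : maxType T φ x = m) :
    (∀ y : V, T.Adj x y →
      maxType T φ y = m - 1 ∨ maxType T φ y = m ∨ maxType T φ y = m + 1) ∧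
    (∃ y : V, T.Adj x y ∧ maxType T φ y = m + 1) ∧
    ((∃ z : V, maxType T φ z < m) → ∃ y : V, T.Adj x y ∧ maxType T φ y = m - 1) := by
  have hT := htree.connected
  have hS := hst.isSplitting hT fun v => Set.finite_of_ncard_ne_zero (by rw [hreg]; omega)
  have hb := exists_mem_stable hbd
  simp only [maxType_eq_rank hbd] at hx ⊢
  refine ⟨fun y hy => ?_, ?_, ?_⟩
  · have h1 := hS.rank_le_succ_of_adj hb hy
    have h2 := hS.rank_le_succ_of_adj hb hy.symm
    omega
  · obtain ⟨y, hy, hr⟩ := hS.exists_adj_rank_succ hb x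
    exact ⟨y, hy, by omega⟩
  · rintro ⟨z, hz⟩
    obtain ⟨y, hy, hr⟩ := hS.exists_adj_rank_pred hb (x := x) (z := z) (by omega)
    exact ⟨y, hy, by omega⟩
end
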